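/- Let r ≥ 9 be an integer and let G be a finite simple graph with maximum degree at most r that satisfies the semi-planar edge bounds. Then G admits an equitable r-coloring. (This is Theorem 1.3 of the paper, stated for semi-planar graphs, i.e. graphs embeddable into a surface of non-negative Euler characteristic; such graphs satisfy the semi-planar edge bounds by Euler's formula, and the paper's proof uses the embedding only through these bounds.) -/

import Mathlib

open scoped Classical

namespace Equitable

variable {V : Type*}

/-- An equitable `r`-coloring of `G`: a proper coloring with `r` colors whose
color classes pairwise differ in size by at most `1`. -/
def IsEquitableColoring [Fintype V] (G : SimpleGraph V) (r : ℕ) (c : V → Fin r) : Prop :=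
  (∀ u v : V, G.Adj u v → c u ≠ c v) ∧
  ∀ i j : Fin r,
    (Finset.univ.filter fun v => c v = i).card ≤
      (Finset.univ.filter fun v => c v = j).card + 1

/-- The number of edges of `G` with both endpoints in `S`. -/
noncomputable def edgesWithin [Fintype V] (G : SimpleGraph V) (S : Finset V) : ℕ :=
  (G.edgeFinset.filter fun e => ∀ v ∈ e, v ∈ S).card

/-- The number of edges of `G` with one endpoint in `X` and the other in `Y`. -/
noncomputable def edgesBetween [Fintype V] (G : SimpleGraph V) (X Y : Finset V) : ℕ :=
  (G.edgeFinset.filter fun e => ∃ u ∈ X, ∃ w ∈ Y, e = s(u, w)).card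

/-- The semi-planar edge bounds. -/
def SemiPlanarBounds [Fintype V] (G : SimpleGraph V) : Prop :=
  (∀ S : Finset V, edgesWithin G S ≤ 3 * S.card) ∧
  ∀ X Y : Finset V, Disjoint X Y → edgesBetween G X Y ≤ 2 * (X.card + Y.card)

/-- The planar edge bounds. -/
def PlanarBounds [Fintype V] (G : SimpleGraph V) : Prop :=
  (∀ S : Finset V, 3 ≤ S.card → edgesWithin G S ≤ 3 * S.card - 6) ∧
  ∀ X Y : Finset V, Disjoint X Y → 3 ≤ X.card + Y.card →
    edgesBetween G X Y ≤ 2 * (X.card + Y.card) - 4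

/-- The semi-planar bipartite edge bound. -/
def SemiPlanarBipBound [Fintype V] (G : SimpleGraph V) : Prop :=
  ∀ X Y : Finset V, Disjoint X Y → edgesBetween G X Y ≤ 2 * (X.card + Y.card)

/-- The planar bipartite edge bound. -/
def PlanarBipBound [Fintype V] (G : SimpleGraph V) : Prop :=
  ∀ X Y : Finset V, Disjoint X Y → 3 ≤ X.card + Y.card →
    edgesBetween G X Y ≤ 2 * (X.card + Y.card) - 4

/-- `P` is an almost equitable coloring of `G − x`: a partition of `V(G) \ {x}` into `r`
independent sets, the small class `P 0` of size `s − 1` and the other classes of size `s`. -/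
def AEColoring [Fintype V] (G : SimpleGraph V) (x : V) {r : ℕ} [NeZero r] (s : ℕ)
    (P : Fin r → Finset V) : Prop :=
  (∀ i j : Fin r, i ≠ j → Disjoint (P i) (P j)) ∧
  (∀ v : V, (∃ i, v ∈ P i) ↔ v ≠ x) ∧
  (∀ i : Fin r, ∀ u ∈ P i, ∀ w ∈ P i, ¬ G.Adj u w) ∧
  (P 0).card = s - 1 ∧
  ∀ i : Fin r, i ≠ 0 → (P i).card = s

/-- The arc relation of the auxiliary digraph `H`: an arc from class `i` to class `j`
iff `i ≠ j` and some vertex of `P i` has no `G`-neighbor in `P j` (such a vertex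
is a witness of the arc and is called movable to `P j`). -/
def Arc (G : SimpleGraph V) {r : ℕ} (P : Fin r → Finset V) (i j : Fin r) : Prop :=
  i ≠ j ∧ ∃ v ∈ P i, ∀ u ∈ P j, ¬ G.Adj v u

/-- A class is accessible if the auxiliary digraph has a directed path (possibly of
length `0`) from it to the small class `P 0`. -/
def Accessible (G : SimpleGraph V) {r : ℕ} [NeZero r] (P : Fin r → Finset V)
    (i : Fin r) : Prop :=
  Relation.ReflTransGen (Arc G P) i 0

/-- The number of accessible classes. -/
noncomputable def accCount (G : SimpleGraph V) {r : ℕ} [NeZero r]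
    (P : Fin r → Finset V) : ℕ :=
  (Finset.univ.filter fun i => Accessible G P i).card

/-- No almost equitable coloring of `G − x` has more accessible classes than `P`. -/
def MaxAccessible [Fintype V] (G : SimpleGraph V) (x : V) {r : ℕ} [NeZero r] (s : ℕ)
    (P : Fin r → Finset V) : Prop :=
  ∀ P' : Fin r → Finset V, AEColoring G x s P' → accCount G P' ≤ accCount G P

/-- Class `i` blocks class `j` if `i ≠ j` and the auxiliary digraph minus the
class `i` has no directed path from `j` to the small class `P 0`. -/
def Blocks (G : SimpleGraph V) {r : ℕ} [NeZero r] (P : Fin r → Finset V)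
    (i j : Fin r) : Prop :=
  i ≠ j ∧ ¬ Relation.ReflTransGen (fun p q => Arc G P p q ∧ p ≠ i ∧ q ≠ i) j 0

/-- An accessible class is terminal if it blocks no accessible class. -/
def Terminal (G : SimpleGraph V) {r : ℕ} [NeZero r] (P : Fin r → Finset V)
    (i : Fin r) : Prop :=
  Accessible G P i ∧ ∀ j : Fin r, Accessible G P j → ¬ Blocks G P i j

/-- `u` is a solo neighbor of `v` (where `v` lies in the accessible class `P i`):
`u` lies in a non-accessible class, is adjacent to `v`, and `v` is the unique
neighbor of `u` in `P i`.  `Q(v)` is the set of such `u`. -/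
def SoloNbr (G : SimpleGraph V) {r : ℕ} [NeZero r] (P : Fin r → Finset V)
    (i : Fin r) (v u : V) : Prop :=
  (∃ k : Fin r, ¬ Accessible G P k ∧ u ∈ P k) ∧ G.Adj v u ∧
    ∀ w ∈ P i, G.Adj u w → w = v

/-- `u ∈ Q'(v)`: `u` is a solo neighbor of `v` that is non-adjacent to some other
solo neighbor of `v`. -/
def InQ' (G : SimpleGraph V) {r : ℕ} [NeZero r] (P : Fin r → Finset V)
    (i : Fin r) (v u : V) : Prop :=
  SoloNbr G P i v u ∧ ∃ u' : V, SoloNbr G P i v u' ∧ u' ≠ u ∧ ¬ G.Adj u u'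

/-- A vertex `v` of a terminal accessible class `P i` is ordinary if some other vertex of
`P i` is movable to another accessible class, or there are at most two accessible classes. -/
def Ordinary (G : SimpleGraph V) {r : ℕ} [NeZero r] (P : Fin r → Finset V)
    (i : Fin r) (v : V) : Prop :=
  (∃ v' ∈ P i, v' ≠ v ∧
    ∃ j : Fin r, j ≠ i ∧ Accessible G P j ∧ ∀ w ∈ P j, ¬ G.Adj v' w) ∨
  accCount G P ≤ 2

/-- The strong component of the auxiliary digraph containing class `i`. -/
noncomputable def strongComp (G : SimpleGraph V) {r : ℕ} (P : Fin r → Finset V)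
    (i : Fin r) : Finset (Fin r) :=
  Finset.univ.filter fun j =>
    Relation.ReflTransGen (Arc G P) i j ∧ Relation.ReflTransGen (Arc G P) j i

/-- The number of neighbors of `v` in `X`. -/
noncomputable def nb (G : SimpleGraph V) (v : V) (X : Finset V) : ℕ :=
  (X.filter (G.Adj v)).card

/-- Degree bound and semi-planar edge bounds, expressed through neighbor counts. -/
structure Sparse (G : SimpleGraph V) (r : ℕ) : Prop where
  deg : ∀ v X, nb G v X ≤ r
  within : ∀ S : Finset V, ∑ v ∈ S, nb G v S ≤ 6 * S.card
  between : ∀ X Y : Finset V, Disjoint X Y → ∑ y ∈ Y, nb G y X ≤ 2 * (X.card + Y.card)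

/-- `T` is an independent set. -/
def Indep (G : SimpleGraph V) (T : Finset V) : Prop := ∀ u ∈ T, ∀ v ∈ T, ¬ G.Adj u v

/-- `c` properly colors the vertices of `S` with colors from `C`. -/
def PColor (G : SimpleGraph V) (S : Finset V) (c : V → ℕ) (C : Finset ℕ) : Prop :=
  (∀ v ∈ S, c v ∈ C) ∧ ∀ u ∈ S, ∀ v ∈ S, G.Adj u v → c u ≠ c v

/-- The color class of `i` in `S`. -/
def cls (S : Finset V) (c : V → ℕ) (i : ℕ) : Finset V := S.filter (c · = i)

/-- `S` can be partitioned into `k` independent sets of size `s`. -/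
def Tiles (G : SimpleGraph V) (S : Finset V) (k s : ℕ) : Prop :=
  ∃ (c : V → ℕ) (C : Finset ℕ), C.card = k ∧ PColor G S c C ∧ ∀ i ∈ C, (cls S c i).card = s

/-- The vertices of `M` whose only neighbor in `W` is `w`. -/
noncomputable def solo (G : SimpleGraph V) (W M : Finset V) (w : V) : Finset V :=
  M.filter fun y => G.Adj w y ∧ ∀ u ∈ W, G.Adj y u → u = w

section Counting

variable {G : SimpleGraph V} {r s k : ℕ}

lemma mem_cls {S : Finset V} {c : V → ℕ} {i : ℕ} {v : V} :
    v ∈ cls S c i ↔ v ∈ S ∧ c v = i := by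
  simp [cls]

lemma mem_solo {W M : Finset V} {w y : V} :
    y ∈ solo G W M w ↔ y ∈ M ∧ G.Adj w y ∧ ∀ u ∈ W, G.Adj y u → u = w := by
  simp [solo]

lemma nb_pos {v : V} {X : Finset V} : 1 ≤ nb G v X ↔ ∃ u ∈ X, G.Adj v u := by
  simp [nb, Nat.one_le_iff_ne_zero, Finset.filter_eq_empty_iff]

lemma nb_eq_zero {v : V} {X : Finset V} : nb G v X = 0 ↔ ∀ u ∈ X, ¬ G.Adj v u := by
  simp [nb, Finset.filter_eq_empty_iff]

lemma nb_mono (v : V) {X Y : Finset V} (h : X ⊆ Y) : nb G v X ≤ nb G v Y :=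
  Finset.card_le_card (Finset.filter_subset_filter _ h)

lemma nb_union (v : V) {X Y : Finset V} (h : Disjoint X Y) :
    nb G v (X ∪ Y) = nb G v X + nb G v Y := by
  unfold nb
  rw [Finset.filter_union, Finset.card_union_of_disjoint (Finset.disjoint_filter_filter h)]

lemma nb_erase_add_one {v y : V} {X : Finset V} (hy : y ∈ X) (h : G.Adj v y) :
    nb G v (X.erase y) + 1 = nb G v X := by
  unfold nb
  rw [Finset.filter_erase, Finset.card_erase_add_one (by simp [hy, h])]

lemma sum_nb_comm (X Y : Finset V) : ∑ y ∈ Y, nb G y X = ∑ x ∈ X, nb G x Y := by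
  have := Finset.sum_card_bipartiteAbove_eq_sum_card_bipartiteBelow (s := Y) (t := X) G.Adj
  simp only [Finset.bipartiteAbove, Finset.bipartiteBelow] at this
  simpa [nb, G.adj_comm] using this

lemma card_le_nb_of_forall_color {S : Finset V} {c : V → ℕ} {D : Finset ℕ} {v : V}
    (h : ∀ k ∈ D, ∃ u ∈ S, c u = k ∧ G.Adj v u) :
    D.card ≤ nb G v (S.filter (c · ∈ D)) := by
  refine (Finset.card_le_card (t := ((S.filter (c · ∈ D)).filter (G.Adj v)).image c) ?_).trans
    Finset.card_image_le
  intro k hk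
  obtain ⟨u, hu, rfl, huv⟩ := h k hk
  exact Finset.mem_image_of_mem _ (by simp [hu, hk, huv])

lemma card_filter_color (S : Finset V) (c : V → ℕ) (D : Finset ℕ) :
    (S.filter (c · ∈ D)).card = ∑ i ∈ D, (cls S c i).card := by
  rw [Finset.card_eq_sum_card_fiberwise (f := c) (t := D) (fun _ hv => by
    simp only [Finset.coe_filter, Set.mem_ofPred_eq] at hv; exact hv.2)]
  refine Finset.sum_congr rfl fun i hi => congrArg _ ?_
  ext v
  simp only [Finset.mem_filter, mem_cls]
  grind

lemma two_mul_card_le_sum_solo {W M : Finset V} (h : ∀ y ∈ M, 1 ≤ nb G y W) :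
    2 * M.card ≤ ∑ w ∈ W, (nb G w M + (solo G W M w).card) := by
  have h1 : ∑ w ∈ W, (solo G W M w).card
      = ∑ y ∈ M, (W.filter fun w => G.Adj w y ∧ ∀ u ∈ W, G.Adj y u → u = w).card :=
    Finset.sum_card_bipartiteAbove_eq_sum_card_bipartiteBelow
      (fun w y => G.Adj w y ∧ ∀ u ∈ W, G.Adj y u → u = w)
  rw [Finset.sum_add_distrib, h1, ← sum_nb_comm, ← Finset.sum_add_distrib, mul_comm,
    ← smul_eq_mul, ← Finset.sum_const]
  refine Finset.sum_le_sum fun y hy => ?_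
  obtain ⟨w, hw, hyw⟩ := nb_pos.1 (h y hy)
  by_cases h2 : 2 ≤ nb G y W
  · omega
  have h3 : nb G y W = 1 := le_antisymm (by omega) (h y hy)
  obtain ⟨w', hw'⟩ := Finset.card_eq_one.1 h3
  have h4 : 1 ≤ (W.filter fun w => G.Adj w y ∧ ∀ u ∈ W, G.Adj y u → u = w).card := by
    refine Finset.card_pos.2 ⟨w, ?_⟩
    have key : ∀ u ∈ W, G.Adj y u → u = w' := fun u hu hyu => by
      have : u ∈ W.filter (G.Adj y) := by simp [hu, hyu]
      simpa [hw'] using this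
    simp only [Finset.mem_filter]
    exact ⟨hw, hyw.symm, fun u hu hyu => (key u hu hyu).trans (key w hw hyw).symm⟩
  omega

end Counting

section Tilings

variable {G : SimpleGraph V} {r s k : ℕ}

lemma PColor.glue {A B : Finset V} {cA cB : V → ℕ} {D E : Finset ℕ}
    (hA : PColor G A cA D) (hB : PColor G B cB E) (hAB : Disjoint A B) (hDE : Disjoint D E) :
    ∃ c, PColor G (A ∪ B) c (D ∪ E) ∧ (∀ i ∈ D, cls (A ∪ B) c i = cls A cA i) ∧
      ∀ i ∈ E, cls (A ∪ B) c i = cls B cB i := by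
  rw [Finset.disjoint_left] at hAB hDE
  obtain ⟨hA1, hA2⟩ := hA
  obtain ⟨hB1, hB2⟩ := hB
  refine ⟨fun v => if v ∈ A then cA v else cB v, ⟨?_, ?_⟩, ?_, ?_⟩
  · intro v hv
    grind
  · intro u hu v hv huv
    have := hA2 u
    have := hB2 u
    grind
  · intro i hi
    ext v
    simp only [mem_cls]
    grind
  · intro i hi
    ext v
    simp only [mem_cls]
    grind

lemma PColor.filter {S : Finset V} {c : V → ℕ} {C : Finset ℕ} (h : PColor G S c C)
    (D : Finset ℕ) : PColor G (S.filter (c · ∈ D)) c D :=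
  ⟨fun _ hv => (Finset.mem_filter.1 hv).2, fun u hu v hv =>
    h.2 u (Finset.mem_filter.1 hu).1 v (Finset.mem_filter.1 hv).1⟩

lemma cls_filter {S : Finset V} {c : V → ℕ} {D : Finset ℕ} {i : ℕ} (hi : i ∈ D) :
    cls (S.filter (c · ∈ D)) c i = cls S c i := by
  ext v
  simp only [mem_cls, Finset.mem_filter]
  grind

lemma PColor.indep_cls {S : Finset V} {c : V → ℕ} {C : Finset ℕ} (h : PColor G S c C) (i : ℕ) :
    Indep G (cls S c i) := fun u hu v hv huv =>
  h.2 u (mem_cls.1 hu).1 v (mem_cls.1 hv).1 huv ((mem_cls.1 hu).2.trans (mem_cls.1 hv).2.symm)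

lemma Indep.pColor {T : Finset V} (h : Indep G T) (i : ℕ) : PColor G T (fun _ => i) {i} :=
  ⟨fun _ _ => Finset.mem_singleton_self i, fun u hu v hv huv => absurd huv (h u hu v hv)⟩

lemma Indep.mono {T T' : Finset V} (h : Indep G T) (hT : T' ⊆ T) : Indep G T' :=
  fun u hu v hv => h u (hT hu) v (hT hv)

lemma Indep.cons {T : Finset V} (h : Indep G T) {v : V} (hv : ∀ u ∈ T, ¬ G.Adj v u) :
    Indep G (insert v T) := by
  intro a ha b hb hab
  have := h a
  have := G.adj_comm a b
  have := G.loopless.irrefl a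
  grind

lemma cls_const (T : Finset V) (i : ℕ) : cls T (fun _ => i) i = T := by
  ext v
  simp [mem_cls]

lemma Tiles.of_filter {S : Finset V} {c : V → ℕ} {C D : Finset ℕ} (h : PColor G S c C)
    (hs : ∀ i ∈ D, (cls S c i).card = s) : Tiles G (S.filter (c · ∈ D)) D.card s :=
  ⟨c, D, rfl, h.filter D, fun i hi => by rw [cls_filter hi, hs i hi]⟩

lemma Tiles.cons {S T : Finset V} (h : Tiles G S k s) (hT : Indep G T) (hc : T.card = s)
    (hd : Disjoint S T) : Tiles G (S ∪ T) (k + 1) s := by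
  obtain ⟨c, C, rfl, h1, h2⟩ := h
  obtain ⟨n, hn⟩ := Infinite.exists_notMem_finset C
  obtain ⟨c', h3, h4, h5⟩ := h1.glue (hT.pColor n) hd (by simpa using hn)
  refine ⟨c', C ∪ {n}, by rw [Finset.card_union_of_disjoint (by simpa using hn)]; rfl, h3, ?_⟩
  intro i hi
  rcases Finset.mem_union.1 hi with hi | hi
  · rw [h4 i hi, h2 i hi]
  · rw [h5 i hi, Finset.mem_singleton.1 hi, cls_const, hc]

lemma Tiles.cons_two {S A B U : Finset V} (h : Tiles G S k s) (hA : Indep G A) (hAc : A.card = s)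
    (hB : Indep G B) (hBc : B.card = s) (hSA : Disjoint S A) (hSB : Disjoint S B)
    (hAB : Disjoint A B) (hU : S ∪ A ∪ B = U) : Tiles G U (k + 2) s :=
  hU ▸ (h.cons hA hAc hSA).cons hB hBc (Finset.disjoint_union_left.2 ⟨hSB, hAB⟩)

lemma Tiles.card {S : Finset V} (h : Tiles G S k s) : S.card = k * s := by
  obtain ⟨c, C, rfl, h1, h2⟩ := h
  rw [← Finset.filter_true_of_mem h1.1, card_filter_color, Finset.sum_congr rfl h2]
  simp

lemma filter_erase_color {S : Finset V} {c : V → ℕ} {C : Finset ℕ} (h : PColor G S c C) (i : ℕ) :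
    S.filter (c · ∈ C.erase i) = S \ cls S c i := by
  have := h.1
  ext v
  simp only [Finset.mem_filter, Finset.mem_sdiff, mem_cls, Finset.mem_erase]
  grind

lemma Tiles.split {S : Finset V} {z : V} (h : Tiles G S (k + 1) s) (hz : z ∈ S) :
    ∃ T ⊆ S, z ∈ T ∧ Indep G T ∧ T.card = s ∧ Tiles G (S \ T) k s := by
  obtain ⟨c, C, hC, h1, h2⟩ := h
  refine ⟨cls S c (c z), Finset.filter_subset _ _, mem_cls.2 ⟨hz, rfl⟩, h1.indep_cls _,
    h2 _ (h1.1 z hz), ?_⟩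
  rw [← filter_erase_color h1]
  have := Tiles.of_filter (D := C.erase (c z)) h1 fun i hi => h2 i (Finset.mem_of_mem_erase hi)
  rwa [Finset.card_erase_of_mem (h1.1 z hz), hC] at this

lemma PColor.extend {S : Finset V} {c : V → ℕ} {C : Finset ℕ} {v : V} {k : ℕ}
    (h : PColor G S c C) (hv : v ∉ S) (hk : k ∈ C) (hf : ∀ u ∈ S, c u = k → ¬ G.Adj v u) :
    ∃ c', PColor G (insert v S) c' C ∧
      ∀ i, (cls (insert v S) c' i).card = (cls S c i).card + if i = k then 1 else 0 := by
  obtain ⟨h1, h2⟩ := h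
  refine ⟨Function.update c v k, ⟨?_, ?_⟩, ?_⟩
  · intro u hu
    grind [Function.update_apply]
  · intro a ha b hb hab
    have := h2 a
    have := G.adj_comm a b
    have := G.loopless.irrefl a
    grind [Function.update_apply]
  · intro i
    split_ifs with hi
    · rw [← Finset.card_insert_of_notMem (a := v) (by simp [mem_cls, hv])]
      congr 1
      ext u
      simp only [mem_cls, Finset.mem_insert, Function.update_apply]
      grind
    · rw [add_zero]
      congr 1
      ext u
      simp only [mem_cls, Finset.mem_insert, Function.update_apply]
      grind

/-- Any outside vertex with no neighbor in some class in `D` can be absorbed into the classes in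
`D`, at the cost of enlarging the class `j`. -/
def Absorbs (G : SimpleGraph V) (S : Finset V) (c : V → ℕ) (j : ℕ) (D : Finset ℕ) : Prop :=
  ∀ v, (v ∈ S → c v ∉ D) → ∀ k ∈ D, (∀ u ∈ S, c u = k → ¬ G.Adj v u) →
    ∃ c', PColor G (insert v (S.filter (c · ∈ D))) c' D ∧ ∀ i ∈ D,
      (cls (insert v (S.filter (c · ∈ D))) c' i).card = (cls S c i).card + if i = j then 1 else 0

lemma absorbs_singleton {S : Finset V} {c : V → ℕ} {C : Finset ℕ} (h : PColor G S c C) (j : ℕ) :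
    Absorbs G S c j {j} := by
  intro v hv k hk hf
  rw [Finset.mem_singleton] at hk
  subst hk
  obtain ⟨c', h1, h2⟩ := (h.filter {k}).extend (v := v) (k := k) (by simp; grind) (by simp)
    (by intro u hu; exact hf u (Finset.mem_filter.1 hu).1)
  exact ⟨c', h1, fun i hi => by rw [h2 i, cls_filter hi]⟩

lemma Absorbs.extend {S : Finset V} {c : V → ℕ} {C D : Finset ℕ} {j k : ℕ} {u : V}
    (h : PColor G S c C) (hD : Absorbs G S c j D) (hj : j ∈ D) (hu : u ∈ S) (huD : c u ∉ D)
    (hk : k ∈ D) (hf : ∀ v ∈ S, c v = k → ¬ G.Adj u v) : Absorbs G S c j (insert (c u) D) := by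
  intro v hv k' hk' hf'
  have hij : c u ≠ j := fun e => huD (e ▸ hj)
  rcases Finset.mem_insert.1 hk' with rfl | hk'
  · obtain ⟨c', h1, h2⟩ := hD u (fun _ => huD) k hk hf
    have hI : Indep G (insert v ((cls S c (c u)).erase u)) := by
      refine ((h.indep_cls (c u)).mono (Finset.erase_subset _ _)).cons fun w hw => ?_
      have hw := mem_cls.1 (Finset.mem_of_mem_erase hw)
      exact hf' w hw.1 hw.2
    obtain ⟨c'', h3, h4, h5⟩ := h1.glue (hI.pColor (c u))
      (by rw [Finset.disjoint_left]; simp only [Finset.mem_insert, Finset.mem_filter,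
            Finset.mem_erase, mem_cls] at *; grind) (by simpa using huD)
    have e : insert u (S.filter (c · ∈ D)) ∪ insert v ((cls S c (c u)).erase u)
        = insert v (S.filter (c · ∈ insert (c u) D)) := by
      ext a
      simp only [Finset.mem_union, Finset.mem_insert, Finset.mem_filter, Finset.mem_erase, mem_cls]
      grind
    have e' : D ∪ {c u} = insert (c u) D := by rw [Finset.union_comm]; rfl
    rw [e] at h3 h4 h5
    rw [e'] at h3
    refine ⟨c'', h3, fun i hi => ?_⟩
    rcases Finset.mem_insert.1 hi with rfl | hi
    · have hvc : v ∉ (cls S c (c u)).erase u := by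
        simp only [Finset.mem_erase, mem_cls]
        grind
      rw [h5 _ (Finset.mem_singleton_self _), cls_const, Finset.card_insert_of_notMem hvc,
        Finset.card_erase_add_one (mem_cls.2 ⟨hu, rfl⟩), if_neg hij, add_zero]
    · rw [h4 i hi, h2 i hi]
  · obtain ⟨c', h1, h2⟩ := hD v (fun hvS hvD => hv hvS (Finset.mem_insert_of_mem hvD)) k' hk' hf'
    obtain ⟨c'', h3, h4, h5⟩ := h1.glue ((h.indep_cls (c u)).pColor (c u))
      (by rw [Finset.disjoint_left]; simp only [Finset.mem_insert, Finset.mem_filter,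
            mem_cls] at *; grind) (by simpa using huD)
    have e : insert v (S.filter (c · ∈ D)) ∪ cls S c (c u)
        = insert v (S.filter (c · ∈ insert (c u) D)) := by
      ext a
      simp only [Finset.mem_union, Finset.mem_insert, Finset.mem_filter, mem_cls]
      grind
    have e' : D ∪ {c u} = insert (c u) D := by rw [Finset.union_comm]; rfl
    rw [e] at h3 h4 h5
    rw [e'] at h3
    refine ⟨c'', h3, fun i hi => ?_⟩
    rcases Finset.mem_insert.1 hi with rfl | hi
    · rw [h5 _ (Finset.mem_singleton_self _), cls_const, if_neg hij, add_zero]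
    · rw [h4 i hi, h2 i hi]

/-- The set of colors from which the class `j` can be reached by moving vertices. -/
lemma exists_reach {S : Finset V} {c : V → ℕ} {C : Finset ℕ} {j : ℕ} (h : PColor G S c C)
    (hj : j ∈ C) : ∃ D ⊆ C, j ∈ D ∧
      (∀ u ∈ S, c u ∉ D → ∀ k ∈ D, ∃ v ∈ S, c v = k ∧ G.Adj u v) ∧
      ∀ v ∉ S, ∀ k ∈ D, (∀ u ∈ S, c u = k → ¬ G.Adj v u) →
        ∃ c', PColor G (insert v S) c' C ∧ ∀ i ∈ C,
          (cls (insert v S) c' i).card = (cls S c i).card + if i = j then 1 else 0 := by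
  obtain ⟨D, hD, hmax⟩ := Finset.exists_max_image
    (C.powerset.filter fun D => j ∈ D ∧ Absorbs G S c j D) Finset.card
    ⟨{j}, by simp [hj, absorbs_singleton h]⟩
  simp only [Finset.mem_filter, Finset.mem_powerset] at hD hmax
  obtain ⟨hDC, hjD, hA⟩ := hD
  refine ⟨D, hDC, hjD, ?_, ?_⟩
  · intro u hu huD k hk
    by_contra! hf
    have := hmax (insert (c u) D) ⟨Finset.insert_subset (h.1 u hu) hDC,
      Finset.mem_insert_of_mem hjD, hA.extend h hjD hu huD hk hf⟩
    rw [Finset.card_insert_of_notMem huD] at this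
    omega
  · intro v hv k hk hf
    obtain ⟨c', h1, h2⟩ := hA v (fun h => absurd h hv) k hk hf
    obtain ⟨c'', h3, h4, h5⟩ := h1.glue (h.filter (C \ D))
      (by rw [Finset.disjoint_left]; simp only [Finset.mem_insert, Finset.mem_filter,
            Finset.mem_sdiff]; grind) Finset.disjoint_sdiff
    have e : insert v (S.filter (c · ∈ D)) ∪ S.filter (c · ∈ C \ D) = insert v S := by
      have := h.1
      ext a
      simp only [Finset.mem_union, Finset.mem_insert, Finset.mem_filter, Finset.mem_sdiff]
      grind
    rw [e] at h3 h4 h5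
    rw [Finset.union_sdiff_of_subset hDC] at h3
    refine ⟨c'', h3, fun i hi => ?_⟩
    by_cases hiD : i ∈ D
    · rw [h4 i hiD, h2 i hiD]
    · have hij : i ≠ j := fun e => hiD (e ▸ hjD)
      have hiCD := Finset.mem_sdiff.2 ⟨hi, hiD⟩
      rw [h5 i hiCD, cls_filter hiCD, if_neg hij, add_zero]

end Tilings

section Absorption

variable {G : SimpleGraph V} {r s k : ℕ}

lemma mul_card_le_sum_nb {X Y : Finset V} {a : ℕ} (h : ∀ y ∈ Y, a ≤ nb G y X) :
    a * Y.card ≤ ∑ y ∈ Y, nb G y X := by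
  rw [mul_comm, ← smul_eq_mul]
  exact Finset.card_nsmul_le_sum _ _ _ h

lemma card_le_sum_nb_add_one {X Y : Finset V} {x : V} (h : ∀ y ∈ Y, y ≠ x → 1 ≤ nb G y X) :
    Y.card ≤ ∑ y ∈ Y, nb G y X + 1 := by
  have h1 : 1 * (Y.erase x).card ≤ ∑ y ∈ Y.erase x, nb G y X :=
    mul_card_le_sum_nb fun y hy => h y (Finset.mem_of_mem_erase hy) (Finset.ne_of_mem_erase hy)
  have h2 := Finset.pred_card_le_card_erase (s := Y) (a := x)
  have h3 := Finset.sum_le_sum_of_subset (f := fun y => nb G y X) (Finset.erase_subset x Y)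
  omega

lemma card_filter_color_eq {S : Finset V} {c : V → ℕ} {C D : Finset ℕ} {j : ℕ} (hDC : D ⊆ C)
    (hs : ∀ i ∈ C, (cls S c i).card + (if i = j then 1 else 0) = s) :
    (S.filter (c · ∈ D)).card + (if j ∈ D then 1 else 0) = D.card * s := by
  rw [card_filter_color, ← Finset.sum_ite_eq' D j (fun _ => 1), ← Finset.sum_add_distrib,
    Finset.sum_congr rfl fun i hi => hs i (hDC hi), Finset.sum_const, smul_eq_mul]

lemma disjoint_filter_color (S : Finset V) (c : V → ℕ) (C D : Finset ℕ) :
    Disjoint (S.filter (c · ∈ D)) (S.filter (c · ∈ C \ D)) := by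
  rw [Finset.disjoint_left]
  simp only [Finset.mem_filter, Finset.mem_sdiff]
  grind

lemma cuts_contradiction {d e : ℕ} (hd : 1 ≤ d) (he : 1 ≤ e) (hde : 7 ≤ d + e)
    (h1 : (2 + d) * (e * s) ≤ 2 * ((d + e + 2) * s) - 3)
    (h2 : 2 * (d * s) + d * (e * s) ≤ 2 * ((d + e + 2) * s) - 1) (hs : 1 ≤ s) : False := by
  have h1' : (2 + d) * (e * s) + 3 ≤ 2 * ((d + e + 2) * s) := by
    have : 1 ≤ (d + e + 2) * s := Nat.mul_pos (by omega) hs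
    have : 2 ≤ d + e + 2 := by omega
    have : 2 * 1 ≤ (d + e + 2) * s := Nat.mul_le_mul this hs
    omega
  have h2' : 2 * (d * s) + d * (e * s) + 1 ≤ 2 * ((d + e + 2) * s) := by
    have : 1 ≤ (d + e + 2) * s := Nat.mul_pos (by omega) hs
    omega
  rcases Nat.lt_or_ge e 3 with h | h
  · interval_cases e
    · obtain ⟨d', rfl⟩ := Nat.exists_eq_add_of_le (show 6 ≤ d by omega)
      nlinarith
    · obtain ⟨d', rfl⟩ := Nat.exists_eq_add_of_le (show 5 ≤ d by omega)
      nlinarith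
  · obtain ⟨e', rfl⟩ := Nat.exists_eq_add_of_le h
    have : 4 ≤ d * (e' + 1) := by
      rcases Nat.lt_or_ge d 4 with h | h
      · interval_cases d <;> omega
      · nlinarith
    nlinarith [Nat.mul_le_mul_right s this]

lemma absorb_two (hG : Sparse G r) (hr : 9 ≤ r) {W L S : Finset V} {c : V → ℕ} {C : Finset ℕ}
    {j : ℕ} {v x : V} (hC : C.card + 2 = r) (hWL : Disjoint W L) (hWS : Disjoint W S)
    (hLS : Disjoint L S) (hWc : W.card + 1 = s) (hLc : L.card = s) (h : PColor G S c C)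
    (hj : j ∈ C) (hs : ∀ i ∈ C, (cls S c i).card + (if i = j then 1 else 0) = s)
    (hW : ∀ u ∈ S, 1 ≤ nb G u W) (hL : ∀ u ∈ S, u ≠ x → 1 ≤ nb G u L) (hv : v ∉ S)
    (hf : ∃ k ∈ C, ∀ u ∈ S, c u = k → ¬ G.Adj v u) : Tiles G (insert v S) C.card s := by
  obtain ⟨D, hDC, hjD, hblock, habs⟩ := exists_reach h hj
  obtain ⟨k, hkC, hk⟩ := hf
  by_cases hkD : k ∈ D
  · obtain ⟨c', h1, h2⟩ := habs v hv k hkD hk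
    exact ⟨c', C, rfl, h1, fun i hi => by rw [h2 i hi, hs i hi]⟩
  exfalso
  have hcE : (C \ D).card + D.card = C.card := Finset.card_sdiff_add_card_eq_card hDC
  have hdisj := disjoint_filter_color S c C D
  have hsD := card_filter_color_eq hDC hs
  have hsE := card_filter_color_eq (D := C \ D) Finset.sdiff_subset hs
  rw [if_pos hjD] at hsD
  rw [if_neg (by simp [hjD]), add_zero] at hsE
  have hd : 1 ≤ D.card := Finset.card_pos.2 ⟨j, hjD⟩
  have he : 1 ≤ (C \ D).card := Finset.card_pos.2 ⟨k, by simp [hkC, hkD]⟩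
  set SD := S.filter (c · ∈ D) with hSD
  set SE := S.filter (c · ∈ C \ D) with hSE
  have hSDS : SD ⊆ S := Finset.filter_subset _ _
  have hSES : SE ⊆ S := Finset.filter_subset _ _
  have e1 : D.card * SE.card ≤ ∑ y ∈ SE, nb G y SD := mul_card_le_sum_nb fun y hy => by
    simp only [hSE, Finset.mem_filter, Finset.mem_sdiff] at hy
    exact card_le_nb_of_forall_color (hblock y hy.1 hy.2.2)
  have e2 : ∀ Y ⊆ S, Y.card ≤ ∑ y ∈ Y, nb G y W := fun Y hY => by
    simpa using mul_card_le_sum_nb (a := 1) fun y hy => hW y (hY hy)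
  have e3 : ∀ Y ⊆ S, Y.card ≤ ∑ y ∈ Y, nb G y L + 1 := fun Y hY =>
    card_le_sum_nb_add_one fun y hy => hL y (hY hy)
  have hWL' : ∀ X ⊆ S, Disjoint (W ∪ L) X := fun X hX =>
    Finset.disjoint_union_left.2 ⟨hWS.mono_right hX, hLS.mono_right hX⟩
  have cA := hG.between (W ∪ L ∪ SD) SE (Finset.disjoint_union_left.2 ⟨hWL' _ hSES, hdisj⟩)
  have cB := hG.between (W ∪ L ∪ SE) SD (Finset.disjoint_union_left.2 ⟨hWL' _ hSDS, hdisj.symm⟩)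
  simp only [nb_union _ (hWL' _ hSDS), nb_union _ (hWL' _ hSES), nb_union _ hWL,
    Finset.sum_add_distrib, Finset.card_union_of_disjoint (hWL' _ hSDS),
    Finset.card_union_of_disjoint (hWL' _ hSES), Finset.card_union_of_disjoint hWL] at cA cB
  have := e2 _ hSDS
  have := e2 _ hSES
  have := e3 _ hSDS
  have := e3 _ hSES
  have e4 := sum_nb_comm (G := G) SE SD
  generalize D.card = d at *
  generalize (C \ D).card = e at *
  have hE : (d + e + 2) * s = d * s + e * s + 2 * s := by ring
  have hE' : (2 + d) * (e * s) = 2 * (e * s) + d * (e * s) := by ring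
  rw [hsE] at e1
  refine cuts_contradiction hd he (by omega) ?_ ?_ (s := s) (by omega)
  · omega
  · omega

end Absorption

section Swapping

variable {G : SimpleGraph V} {r s k : ℕ}

lemma PColor.mono {S S' : Finset V} {c : V → ℕ} {C : Finset ℕ} (h : PColor G S c C)
    (hS : S' ⊆ S) : PColor G S' c C :=
  ⟨fun v hv => h.1 v (hS hv), fun u hu v hv => h.2 u (hS hu) v (hS hv)⟩

lemma card_cls_erase_add {M : Finset V} {c : V → ℕ} {y : V} (hy : y ∈ M) (i : ℕ) :
    (cls (M.erase y) c i).card + (if i = c y then 1 else 0) = (cls M c i).card := by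
  split_ifs with h
  · rw [← Finset.card_erase_add_one (s := cls M c i) (a := y) (mem_cls.2 ⟨hy, h.symm⟩)]
    congr 2
    ext u
    simp only [mem_cls, Finset.mem_erase]
    tauto
  · rw [add_zero]
    congr 1
    ext u
    simp only [mem_cls, Finset.mem_erase]
    grind

lemma exists_free_color {S : Finset V} {c : V → ℕ} {D : Finset ℕ} {v : V}
    (h : nb G v S < D.card) : ∃ k ∈ D, ∀ u ∈ S, c u = k → ¬ G.Adj v u := by
  by_contra! hc
  have := (card_le_nb_of_forall_color hc).trans (nb_mono v (Finset.filter_subset _ S))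
  omega

lemma PColor.swap (hG : Sparse G r) (hr : 9 ≤ r) {W L M : Finset V} {c : V → ℕ} {C : Finset ℕ}
    {v x y : V} (h : PColor G M c C) (hs : ∀ i ∈ C, (cls M c i).card = s) (hC : C.card + 2 = r)
    (hWL : Disjoint W L) (hWM : Disjoint W M) (hLM : Disjoint L M) (hWc : W.card + 1 = s)
    (hLc : L.card = s) (hW : ∀ u ∈ M, 1 ≤ nb G u W) (hL : ∀ u ∈ M, u ≠ x → 1 ≤ nb G u L)
    (hy : y ∈ M) (hv : v ∉ M) (hf : ∃ k ∈ C, ∀ u ∈ M.erase y, c u = k → ¬ G.Adj v u) :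
    Tiles G (insert v (M.erase y)) C.card s := by
  have hM : M.erase y ⊆ M := Finset.erase_subset _ _
  exact absorb_two hG hr hC hWL (hWM.mono_right hM) (hLM.mono_right hM) hWc hLc (h.mono hM)
    (h.1 y hy) (fun i hi => by rw [card_cls_erase_add hy, hs i hi]) (fun u hu => hW u (hM hu))
    (fun u hu => hL u (hM hu)) (fun hvM => hv (hM hvM)) hf

lemma Tiles.swap (hG : Sparse G r) (hr : 9 ≤ r) {W L M : Finset V} {v x y : V}
    (h : Tiles G M k s) (hk : k + 2 = r)
    (hWL : Disjoint W L) (hWM : Disjoint W M) (hLM : Disjoint L M) (hWc : W.card + 1 = s)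
    (hLc : L.card = s) (hW : ∀ u ∈ M, 1 ≤ nb G u W) (hL : ∀ u ∈ M, u ≠ x → 1 ≤ nb G u L)
    (hy : y ∈ M) (hv : v ∉ M) (hf : nb G v (M.erase y) < k) :
    Tiles G (insert v (M.erase y)) k s := by
  obtain ⟨c, C, rfl, h1, h2⟩ := h
  exact h1.swap hG hr h2 hk hWL hWM hLM hWc hLc hW hL hy hv (exists_free_color hf)

lemma Sparse.clique_card (hG : Sparse G r) {w : V} {Q : Finset V} (hw : ∀ y ∈ Q, G.Adj w y)
    (hQ : ∀ y ∈ Q, ∀ z ∈ Q, y ≠ z → G.Adj y z) : Q.card ≤ 6 := by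
  have hwQ : w ∉ Q := fun h => G.loopless.irrefl w (hw w h)
  have h1 : Q.card * (insert w Q).card ≤ ∑ v ∈ insert w Q, nb G v (insert w Q) := by
    refine mul_card_le_sum_nb fun v hv => ?_
    rw [← Nat.add_sub_cancel (n := Q.card) (m := 1), ← Finset.card_insert_of_notMem hwQ,
      ← Finset.card_erase_of_mem hv]
    refine Finset.card_le_card fun u hu => ?_
    have := hw u
    have := hw v
    have := hQ v
    have := G.adj_comm v w
    simp only [Finset.mem_erase, Finset.mem_insert, Finset.mem_filter] at *
    grind
  have h2 := h1.trans (hG.within _)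
  exact Nat.le_of_mul_le_mul_right h2 (Finset.card_pos.2 ⟨w, Finset.mem_insert_self _ _⟩)

lemma card_swap {S : Finset V} {u v : V} (hu : u ∈ S) (hv : v ∉ S) :
    (insert v (S.erase u)).card = S.card := by
  rw [Finset.card_insert_of_notMem (by simp [hv]), Finset.card_erase_add_one hu]

lemma Indep.replace {W M : Finset V} {w y : V} (hW : Indep G W) (hy : y ∈ solo G W M w) :
    Indep G (insert y (W.erase w)) := by
  refine (hW.mono (Finset.erase_subset _ _)).cons fun u hu huy => ?_
  exact Finset.ne_of_mem_erase hu ((mem_solo.1 hy).2.2 u (Finset.mem_of_mem_erase hu) huy)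

lemma Indep.replace_two {W M : Finset V} {w y z : V} (hW : Indep G W) (hy : y ∈ solo G W M w)
    (hz : z ∈ solo G W M w) (hyz : ¬ G.Adj y z) :
    Indep G (insert y (insert z (W.erase w))) := by
  refine (hW.replace hz).cons fun u hu huy => ?_
  rcases Finset.mem_insert.1 hu with rfl | hu
  · exact hyz huy
  · exact Finset.ne_of_mem_erase hu ((mem_solo.1 hy).2.2 u (Finset.mem_of_mem_erase hu) huy)

lemma small_reach_arith {a b : ℕ} (ha : 3 ≤ a) (ha' : a ≤ 6) (hab : 9 ≤ a + b) (hs : 1 ≤ s)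
    (h : a * (b * s) + 2 ≤ 2 * ((a + b) * s)) : False := by
  interval_cases a <;> [obtain ⟨b, rfl⟩ := Nat.exists_eq_add_of_le (show 6 ≤ b by omega);
    obtain ⟨b, rfl⟩ := Nat.exists_eq_add_of_le (show 5 ≤ b by omega);
    obtain ⟨b, rfl⟩ := Nat.exists_eq_add_of_le (show 4 ≤ b by omega);
    obtain ⟨b, rfl⟩ := Nat.exists_eq_add_of_le (show 3 ≤ b by omega)] <;> nlinarith

/-- If the vertex `x` cannot be absorbed, then `V₀` and `V₁` are the only classes from which
the small class `V₀` can be reached. -/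
lemma tiles_or_dominating (hG : Sparse G r) (hr : 9 ≤ r) {V₀ V₁ M : Finset V} {t x : V}
    (hk : k + 2 = r) (h01 : Disjoint V₀ V₁) (h0M : Disjoint V₀ M) (h1M : Disjoint V₁ M)
    (hx0 : x ∉ V₀) (hx1 : x ∉ V₁) (hxM : x ∉ M) (hI0 : Indep G V₀) (hI1 : Indep G V₁)
    (hc0 : V₀.card + 1 = s) (hc1 : V₁.card = s) (hM : Tiles G M k s) (ht : t ∈ V₁)
    (ht0 : nb G t V₀ = 0) (hx : ∀ X, nb G x X ≤ 6) :
    Tiles G (insert x (V₀ ∪ V₁ ∪ M)) r s ∨ ∀ u ∈ insert x M, 1 ≤ nb G u V₀ ∧ 1 ≤ nb G u V₁ := by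
  obtain ⟨c, C, rfl, hc, hs⟩ := hM
  obtain ⟨n₁, hn₁⟩ := Infinite.exists_notMem_finset C
  obtain ⟨n₀, hn₀⟩ := Infinite.exists_notMem_finset ({n₁} ∪ C)
  obtain ⟨c₁, g1, g2, g3⟩ := (hI1.pColor n₁).glue hc h1M (by simpa using hn₁)
  obtain ⟨c₀, f1, f2, f3⟩ := (hI0.pColor n₀).glue g1 (Finset.disjoint_union_right.2 ⟨h01, h0M⟩)
    (Finset.disjoint_singleton_left.2 hn₀)
  rw [← Finset.union_assoc] at f1 f2 f3
  set S := V₀ ∪ V₁ ∪ M with hS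
  set K := {n₀} ∪ ({n₁} ∪ C) with hK
  have k0 : cls S c₀ n₀ = V₀ := by rw [f2 _ (Finset.mem_singleton_self _), cls_const]
  have k1 : cls S c₀ n₁ = V₁ := by
    rw [f3 _ (by simp), g2 _ (Finset.mem_singleton_self _), cls_const]
  have kM : ∀ i ∈ C, cls S c₀ i = cls M c i := fun i hi => by
    rw [f3 _ (by simp [hi]), g3 _ hi]
  have hKc : K.card = r := by
    rw [hK, Finset.card_union_of_disjoint (Finset.disjoint_singleton_left.2 hn₀),
      Finset.card_union_of_disjoint (by simpa using hn₁)]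
    simp
    omega
  have hsz : ∀ i ∈ K, (cls S c₀ i).card + (if i = n₀ then 1 else 0) = s := by
    intro i hi
    simp only [hK, Finset.mem_union, Finset.mem_singleton] at hi hn₀
    push Not at hn₀
    rcases hi with rfl | rfl | hi
    · rw [k0, if_pos rfl, hc0]
    · rw [k1, if_neg hn₀.1.symm, add_zero, hc1]
    · rw [kM i hi, if_neg (fun e : i = n₀ => hn₀.2 (e ▸ hi)), add_zero, hs i hi]
  obtain ⟨D, hDK, h0D, hblock, habs⟩ := exists_reach f1 (j := n₀) (by simp [hK])
  have hxS : x ∉ S := by simp [hS, hx0, hx1, hxM]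
  by_cases hfree : ∃ k ∈ D, ∀ u ∈ S, c₀ u = k → ¬ G.Adj x u
  · obtain ⟨k, hk, hkf⟩ := hfree
    obtain ⟨c', h1, h2⟩ := habs x hxS k hk hkf
    exact Or.inl ⟨c', K, hKc, h1, fun i hi => by rw [h2 i hi, hsz i hi]⟩
  push Not at hfree
  have hD6 : D.card ≤ 6 := (card_le_nb_of_forall_color hfree).trans (hx _)
  have h1D : n₁ ∈ D := by
    by_contra h1D
    have ht1 := mem_cls.1 (k1.symm ▸ ht : t ∈ cls S c₀ n₁)
    obtain ⟨v, hv, hv0, htv⟩ := hblock t ht1.1 (by rwa [ht1.2]) n₀ h0D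
    exact nb_eq_zero.1 ht0 v (k0 ▸ mem_cls.2 ⟨hv, hv0⟩) htv
  have h10 : n₁ ≠ n₀ := fun e => hn₀ (by simp [e])
  have hD2 : D.card ≤ 2 := by
    by_contra hD2
    have hsD := card_filter_color_eq hDK hsz
    have hsE := card_filter_color_eq (D := K \ D) Finset.sdiff_subset hsz
    rw [if_pos h0D] at hsD
    rw [if_neg (by simp [h0D]), add_zero] at hsE
    have hcE : (K \ D).card + D.card = K.card := Finset.card_sdiff_add_card_eq_card hDK
    have cut := hG.between _ _ (disjoint_filter_color S c₀ K D)
    have e1 : D.card * (S.filter (c₀ · ∈ K \ D)).card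
        ≤ ∑ y ∈ S.filter (c₀ · ∈ K \ D), nb G y (S.filter (c₀ · ∈ D)) :=
      mul_card_le_sum_nb fun y hy => by
        simp only [Finset.mem_filter, Finset.mem_sdiff] at hy
        exact card_le_nb_of_forall_color (hblock y hy.1 hy.2.2)
    rw [hsE] at cut e1
    have : (D.card + (K \ D).card) * s = D.card * s + (K \ D).card * s := by ring
    exact small_reach_arith (b := (K \ D).card) (s := s) (by omega) hD6 (by omega) (by omega) (by omega)
  have hD : D = {n₁, n₀} := by
    refine (Finset.eq_of_subset_of_card_le ?_ ?_).symm
    · intro i hi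
      simp only [Finset.mem_insert, Finset.mem_singleton] at hi
      rcases hi with rfl | rfl <;> assumption
    · rwa [Finset.card_pair h10]
  refine Or.inr fun u hu => ?_
  have key : ∀ k ∈ D, ∃ v ∈ S, c₀ v = k ∧ G.Adj u v := by
    rcases Finset.mem_insert.1 hu with rfl | hu
    · exact hfree
    · have huS : u ∈ S := by simp [hS, hu]
      refine hblock u huS fun huD => ?_
      have : u ∈ cls S c₀ (c₀ u) := mem_cls.2 ⟨huS, rfl⟩
      rw [Finset.disjoint_left] at h0M h1M
      simp only [hD, Finset.mem_insert, Finset.mem_singleton] at huD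
      rcases huD with e | e <;> rw [e] at this
      · exact h1M (k1 ▸ this) hu
      · exact h0M (k0 ▸ this) hu
  obtain ⟨a, ha, ha0, hua⟩ := key n₀ h0D
  obtain ⟨b, hb, hb1, hub⟩ := key n₁ h1D
  exact ⟨nb_pos.2 ⟨a, k0 ▸ mem_cls.2 ⟨ha, ha0⟩, hua⟩, nb_pos.2 ⟨b, k1 ▸ mem_cls.2 ⟨hb, hb1⟩, hub⟩⟩

end Swapping

section SmallClass

variable {G : SimpleGraph V} {r s k : ℕ}

lemma nb_erase_erase_insert_lt {u x y z : V} {A M : Finset V} (hA : 1 ≤ nb G u A)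
    (hd : Disjoint A (insert x M)) (hy : y ∈ M) (hz : z ∈ M) (hyz : y ≠ z) (hxy : x ≠ y)
    (huy : G.Adj u y) (huz : G.Adj u z) :
    nb G u ((insert x (M.erase y)).erase z) + 3 ≤ nb G u (A ∪ insert x M) := by
  rw [← Finset.erase_insert_of_ne hxy, nb_union u hd]
  have h1 := nb_erase_add_one (X := insert x M) (Finset.mem_insert_of_mem hy) huy
  have h2 := nb_erase_add_one (X := (insert x M).erase y) (by simp [hz, hyz.symm]) huz
  omega

lemma tiles_of_arc (hG : Sparse G r) (hr : 9 ≤ r) {V₀ V₁ M : Finset V} {t x : V}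
    (hk : k + 2 = r) (h01 : Disjoint V₀ V₁) (h0M : Disjoint V₀ M) (h1M : Disjoint V₁ M)
    (hx0 : x ∉ V₀) (hx1 : x ∉ V₁) (hxM : x ∉ M) (hI0 : Indep G V₀) (hI1 : Indep G V₁)
    (hc0 : V₀.card + 1 = s) (hc1 : V₁.card = s) (hM : Tiles G M k s) (ht : t ∈ V₁)
    (ht0 : nb G t V₀ = 0) (hx : ∀ X, nb G x X ≤ 6) : Tiles G (insert x (V₀ ∪ V₁ ∪ M)) r s := by
  by_contra hnot
  have hdom := (tiles_or_dominating hG hr hk h01 h0M h1M hx0 hx1 hxM hI0 hI1 hc0 hc1 hM ht ht0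
    hx).resolve_left hnot
  have d01 := Finset.disjoint_left.1 h01
  have d0M := Finset.disjoint_left.1 h0M
  have d1M := Finset.disjoint_left.1 h1M
  have hMx : ∀ y ∈ M, Tiles G (insert x (M.erase y)) k s := fun y hy =>
    hM.swap (x := x) hG hr hk h01 h0M h1M hc0 hc1
      (fun u hu => (hdom u (Finset.mem_insert_of_mem hu)).1)
      (fun u hu _ => (hdom u (Finset.mem_insert_of_mem hu)).2) hy hxM
      ((hx _).trans_lt (by omega))
  have hsolo0 : ∀ u ∈ V₁, nb G u V₀ = 0 → (solo G V₁ M u).card = 0 := by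
    intro u hu hu0
    rw [Finset.card_eq_zero, Finset.eq_empty_iff_forall_notMem]
    intro y hy
    have hyM := (mem_solo.1 hy).1
    refine hnot (hk ▸ (hMx y hyM).cons_two (hI0.cons (nb_eq_zero.1 hu0)) ?_ (hI1.replace hy) ?_
      ?_ ?_ ?_ ?_)
    · rw [Finset.card_insert_of_notMem fun h => d01 h hu, hc0]
    · rw [card_swap hu fun h => d1M h hyM, hc1]
    · rw [Finset.disjoint_left]; grind
    · rw [Finset.disjoint_left]; grind
    · rw [Finset.disjoint_left]; grind
    · ext a; grind
  have hclique : ∀ u ∈ V₁, 1 ≤ nb G u V₀ → (solo G V₁ M u).card ≤ 6 := by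
    intro u hu hu0
    refine hG.clique_card (w := u) (fun y hy => (mem_solo.1 hy).2.1) fun y hy z hz hyz => ?_
    by_contra hadj
    have hyM := (mem_solo.1 hy).1
    have hzM := (mem_solo.1 hz).1
    have hut : u ≠ t := fun e => by rw [e, ht0] at hu0; omega
    have hxy : x ≠ y := fun e => hxM (e ▸ hyM)
    have hd : Disjoint V₀ (insert x M) := by
      rw [Finset.disjoint_left]; grind
    have hdeg := (nb_erase_erase_insert_lt hu0 hd hyM hzM hyz hxy (mem_solo.1 hy).2.1
      (mem_solo.1 hz).2.1).trans (hG.deg u _)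
    have hT := (hMx y hyM).swap (x := x) (y := z) (v := u) hG hr hk h01
      (by rw [Finset.disjoint_left]; grind) (by rw [Finset.disjoint_left]; grind) hc0 hc1
      (fun v hv => (hdom v (by grind)).1) (fun v hv _ => (hdom v (by grind)).2) (by grind)
      (by grind) (by omega)
    have hI : Indep G (insert y (insert z ((V₁.erase u).erase t))) :=
      (hI1.replace_two hy hz hadj).mono (by grind)
    refine hnot (hk ▸ hT.cons_two (hI0.cons (nb_eq_zero.1 ht0)) ?_ hI ?_ ?_ ?_ ?_ ?_)
    · rw [Finset.card_insert_of_notMem fun h => d01 h ht, hc0]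
    · rw [Finset.card_insert_of_notMem (by grind), Finset.card_insert_of_notMem (by grind),
        Finset.card_erase_add_one (by grind), Finset.card_erase_add_one hu, hc1]
    · rw [Finset.disjoint_left]; grind
    · rw [Finset.disjoint_left]; grind
    · rw [Finset.disjoint_left]; grind
    · ext a; grind
  have hcount := two_mul_card_le_sum_solo (W := V₁) (M := M) fun y hy =>
    (hdom y (Finset.mem_insert_of_mem hy)).2
  have hlt : ∑ u ∈ V₁, (nb G u M + (solo G V₁ M u).card) < ∑ u ∈ V₁, 2 * k := by
    refine Finset.sum_lt_sum (fun u hu => ?_) ⟨t, ht, ?_⟩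
    · rcases Nat.eq_zero_or_pos (nb G u V₀) with h | h
      · have := hsolo0 u hu h
        have := hG.deg u M
        omega
      · have := hclique u hu h
        have := hG.deg u (V₀ ∪ M)
        rw [nb_union u h0M] at this
        omega
    · have := hsolo0 t ht ht0
      have := hG.deg t M
      omega
  rw [Finset.sum_const, smul_eq_mul, hc1] at hlt
  have := hM.card
  rw [this] at hcount
  nlinarith

/-- If the tilings of `T` and of `S` overlap in a single vertex `z`, then a vertex of low degree
can be absorbed. -/
lemma tiles_of_overlap (hG : Sparse G r) (hr : 9 ≤ r) {T S U : Finset V} {x z : V}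
    (hk : k + 1 = r) (hI : Indep G T) (hTc : T.card = s) (hS : Tiles G S k s) (hzT : z ∈ T)
    (hzS : z ∈ S) (hTS : ∀ v ∈ T, v ∈ S → v = z) (hx : ∀ X, nb G x X ≤ 6)
    (hU : ∀ v, v ∈ U ↔ v = x ∨ v ∈ T ∨ v ∈ S) (hxT : x ∉ T) (hxS : x ∉ S) : Tiles G U r s := by
  obtain ⟨k, rfl⟩ : ∃ k', k = k' + 1 := ⟨k - 1, by omega⟩
  obtain ⟨A, hAS, hzA, hAI, hAc, hM⟩ := hS.split hzS
  have := tiles_of_arc (V₀ := A.erase z) (V₁ := T) (M := S \ A) (t := z) (x := x) hG hr hk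
    (by rw [Finset.disjoint_left]; grind) (by rw [Finset.disjoint_left]; grind)
    (by rw [Finset.disjoint_left]; grind) (by grind) hxT (by grind)
    (hAI.mono (Finset.erase_subset _ _)) hI (by rw [Finset.card_erase_add_one hzA, hAc]) hTc hM hzT
    (nb_eq_zero.2 fun u hu => hAI z hzA u (Finset.mem_of_mem_erase hu)) hx
  convert this using 1
  ext a
  grind

end SmallClass

section SoloBounds

variable {G : SimpleGraph V} {r s k : ℕ}

lemma Sparse.not_dense (hG : Sparse G r) {w : V} {Q C : Finset V} (hw : ∀ y ∈ Q, G.Adj w y)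
    (hQ : 8 ≤ Q.card) (hCQ : C ⊆ Q) (hC : 4 ≤ C.card)
    (hadj : ∀ y ∈ C, ∀ z ∈ Q, y ≠ z → G.Adj y z) : False := by
  obtain ⟨A, hAC, hA⟩ := Finset.exists_subset_card_eq hC
  obtain ⟨B, hAB, hBQ, hB⟩ := Finset.exists_subsuperset_card_eq (hAC.trans hCQ)
    (show A.card ≤ 8 by omega) hQ
  have hwB : w ∉ B := fun h => G.loopless.irrefl w (hw w (hBQ h))
  have h1 : 8 * (insert w A).card ≤ ∑ v ∈ insert w A, nb G v (insert w B) := by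
    refine mul_card_le_sum_nb fun v hv => ?_
    have : ((insert w B).erase v).card = 8 := by
      rw [Finset.card_erase_of_mem (by grind), Finset.card_insert_of_notMem hwB, hB]
    rw [← this]
    refine Finset.card_le_card fun u hu => ?_
    have := hw u
    have := hw v
    have := hadj v
    have := G.adj_comm v w
    simp only [Finset.mem_erase, Finset.mem_insert, Finset.mem_filter] at *
    grind
  have h2 : 5 * (B \ A).card ≤ ∑ v ∈ B \ A, nb G v (insert w B) := by
    refine mul_card_le_sum_nb fun v hv => ?_
    have : (insert w A).card = 5 := by
      rw [Finset.card_insert_of_notMem (by grind), hA]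
    rw [← this]
    refine Finset.card_le_card fun u hu => ?_
    have := hw v
    have := hadj u
    have := G.adj_comm v w
    have := G.adj_comm v u
    simp only [Finset.mem_sdiff, Finset.mem_insert, Finset.mem_filter] at *
    grind
  have h3 := hG.within (insert w B)
  have h4 : insert w A ∪ B \ A = insert w B := by grind
  rw [← h4, Finset.sum_union (by rw [Finset.disjoint_left]; grind), h4,
    Finset.card_insert_of_notMem hwB] at h3
  rw [Finset.card_insert_of_notMem (by grind)] at h1
  rw [Finset.card_sdiff_of_subset hAB] at h2
  omega

lemma card_repeated_add_le (N : Finset V) (c : V → ℕ) :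
    (N.filter fun y => ∃ u ∈ N, u ≠ y ∧ c u = c y).card + 2 * (N.image c).card
      ≤ 2 * N.card := by
  set R := N.filter fun y => ∃ u ∈ N, u ≠ y ∧ c u = c y with hR
  have h1 : 2 * (R.image c).card ≤ R.card := by
    refine Finset.mul_card_image_le_card _ _ fun k hk => ?_
    obtain ⟨y, hy, rfl⟩ := Finset.mem_image.1 hk
    obtain ⟨u, hu, huy, hc⟩ := (Finset.mem_filter.1 hy).2
    rw [← Finset.card_pair huy]
    refine Finset.card_le_card fun v hv => ?_
    grind
  have h2 : (N.image c).card ≤ (R.image c).card + (N \ R).card := by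
    have : N.image c ⊆ R.image c ∪ (N \ R).image c := by
      rw [← Finset.image_union]
      exact Finset.image_subset_image (by grind)
    exact (Finset.card_le_card this).trans ((Finset.card_union_le _ _).trans
      (Nat.add_le_add_left Finset.card_image_le _))
  have h3 : (N \ R).card + R.card = N.card :=
    Finset.card_sdiff_add_card_eq_card (Finset.filter_subset _ _)
  omega

lemma Sparse.card_le_seven (hG : Sparse G r) {w : V} {Q N : Finset V} {c : V → ℕ}
    (hw : ∀ y ∈ Q, G.Adj w y) (hQN : Q ⊆ N)
    (h : ∀ y ∈ Q, ∀ z ∈ Q, y ≠ z → ¬ G.Adj y z → ∃ D : Finset ℕ, c y ∈ D ∧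
      N.card ≤ D.card + 2 ∧ ∀ k ∈ D, ∃ u ∈ N, u ≠ y ∧ c u = k) : Q.card ≤ 7 := by
  by_contra! hQ
  set R := N.filter fun y => ∃ u ∈ N, u ≠ y ∧ c u = c y with hR
  have hadj : ∀ y ∈ Q \ R, ∀ z ∈ Q, y ≠ z → G.Adj y z := by
    intro y hy z hz hyz
    by_contra hn
    obtain ⟨D, hD, -, hk⟩ := h y (by grind) z hz hyz hn
    obtain ⟨u, hu, huy, hc⟩ := hk _ hD
    grind
  by_cases h4 : 4 ≤ (Q \ R).card
  · exact hG.not_dense hw hQ Finset.sdiff_subset h4 hadj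
  have h5 : ∃ y ∈ Q, ∃ z ∈ Q, y ≠ z ∧ ¬ G.Adj y z := by
    by_contra! hc
    have := hG.clique_card hw hc
    omega
  obtain ⟨y, hy, z, hz, hyz, hn⟩ := h5
  obtain ⟨D, -, hDc, hk⟩ := h y hy z hz hyz hn
  have h6 : D.card ≤ (N.image c).card := Finset.card_le_card fun k hkD => by
    obtain ⟨u, hu, -, rfl⟩ := hk k hkD
    exact Finset.mem_image_of_mem _ hu
  have h7 := card_repeated_add_le N c
  rw [← hR] at h7
  have h8 : Q.card ≤ (Q \ R).card + R.card := by
    rw [← Finset.card_union_of_disjoint Finset.sdiff_disjoint]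
    exact Finset.card_le_card (by grind)
  omega

end SoloBounds

section DominatingClass

variable {G : SimpleGraph V} {r s k : ℕ}

lemma card_solo_le (W M : Finset V) (w : V) : (solo G W M w).card ≤ nb G w M :=
  Finset.card_le_card fun y hy => by
    have := mem_solo.1 hy
    simp [this.1, this.2.1]

lemma exists_large_solo {W M : Finset V} (hW : W.card + 1 = s) (hM : M.card = k * s) (hk : 1 ≤ k)
    (h : ∀ y ∈ M, 1 ≤ nb G y W) : ∃ w ∈ W, 2 * k < nb G w M + (solo G W M w).card := by
  by_contra! hc
  have h1 := (two_mul_card_le_sum_solo h).trans (Finset.sum_le_card_nsmul _ _ _ hc)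
  rw [smul_eq_mul, hM, ← hW] at h1
  nlinarith

lemma card_replace_two {W : Finset V} {w y z : V} (hW : W.card + 1 = s) (hw : w ∈ W)
    (hy : y ∉ W) (hz : z ∉ W) (hyz : y ≠ z) : (insert y (insert z (W.erase w))).card = s := by
  rw [Finset.card_insert_of_notMem (by simp [hyz, hy]), card_swap hw hz, hW]

/-- A small class `W`, a full class `L` and a tiled set `M`, such that every vertex of `M` has
neighbors in both `W` and `L`, every vertex of `L` has a neighbor in `W`, and the vertex `x` of
low degree cannot be absorbed. -/
structure Stuck (G : SimpleGraph V) (r k s : ℕ) (W L M : Finset V) (x : V) : Prop where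
  sparse : Sparse G r
  nine_le : 9 ≤ r
  add_two : k + 2 = r
  disjoint_WL : Disjoint W L
  disjoint_WM : Disjoint W M
  disjoint_LM : Disjoint L M
  notMem_W : x ∉ W
  notMem_L : x ∉ L
  notMem_M : x ∉ M
  indep_W : Indep G W
  indep_L : Indep G L
  card_W : W.card + 1 = s
  card_L : L.card = s
  tiles : Tiles G M k s
  nb_MW : ∀ u ∈ M, 1 ≤ nb G u W
  nb_ML : ∀ u ∈ M, 1 ≤ nb G u L
  nb_LW : ∀ u ∈ L, 1 ≤ nb G u W
  nb_x : ∀ X, nb G x X ≤ 6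
  not_tiles : ¬ Tiles G (insert x (W ∪ L ∪ M)) r s

namespace Stuck

variable {W L M : Finset V} {x : V}

lemma not_tiles_of (h : Stuck G r k s W L M x) {M' A B : Finset V} (hM : Tiles G M' k s)
    (hA : Indep G A) (hAc : A.card = s) (hB : Indep G B) (hBc : B.card = s)
    (hMA : ∀ v ∈ M', v ∉ A) (hMB : ∀ v ∈ M', v ∉ B) (hAB : ∀ v ∈ A, v ∉ B)
    (hU : ∀ v, v ∈ M' ∨ v ∈ A ∨ v ∈ B ↔ v = x ∨ v ∈ W ∨ v ∈ L ∨ v ∈ M) : False := by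
  refine h.not_tiles (h.add_two ▸ hM.cons_two hA hAc hB hBc (Finset.disjoint_left.2 hMA)
    (Finset.disjoint_left.2 hMB) (Finset.disjoint_left.2 hAB) ?_)
  ext a
  have := hU a
  simp only [Finset.mem_union, Finset.mem_insert]
  tauto

lemma one_le_nb (h : Stuck G r k s W L M x) : 1 ≤ nb G x W := by
  by_contra h0
  have dWL := Finset.disjoint_left.1 h.disjoint_WL
  have dWM := Finset.disjoint_left.1 h.disjoint_WM
  have dLM := Finset.disjoint_left.1 h.disjoint_LM
  have := h.notMem_L
  have := h.notMem_M
  refine h.not_tiles_of h.tiles h.indep_L h.card_L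
    (h.indep_W.cons (v := x) (nb_eq_zero.1 (by omega))) ?_ ?_ ?_ ?_ ?_
  · rw [Finset.card_insert_of_notMem h.notMem_W, h.card_W]
  all_goals grind

lemma not_overlap (h : Stuck G r k s W L M x) {T S : Finset V} {z : V} (hT : Indep G T)
    (hTc : T.card = s) (hS : Tiles G S (k + 1) s) (hzT : z ∈ T) (hzS : z ∈ S)
    (hTS : ∀ v ∈ T, v ∈ S → v = z) (hU : ∀ v, v ∈ W ∨ v ∈ L ∨ v ∈ M ↔ v ∈ T ∨ v ∈ S) :
    False := by
  have hx : ¬ (x ∈ T ∨ x ∈ S) := by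
    rw [← hU]
    exact fun hx => hx.elim h.notMem_W fun hx => hx.elim h.notMem_L h.notMem_M
  refine h.not_tiles (tiles_of_overlap h.sparse h.nine_le (k := k + 1) h.add_two hT hTc hS hzT hzS
    hTS h.nb_x (fun v => ?_) (fun hxT => hx (Or.inl hxT)) fun hxS => hx (Or.inr hxS))
  rw [← hU]
  simp only [Finset.mem_union, Finset.mem_insert, or_assoc]

lemma swap (h : Stuck G r k s W L M x) {y v : V} (hy : y ∈ M) (hv : v ∉ M)
    (hf : nb G v (M.erase y) < k) : Tiles G (insert v (M.erase y)) k s :=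
  h.tiles.swap (x := x) h.sparse h.nine_le h.add_two h.disjoint_WL h.disjoint_WM h.disjoint_LM
    h.card_W h.card_L h.nb_MW (fun u hu _ => h.nb_ML u hu) hy hv hf

lemma swap_swap (h : Stuck G r k s W L M x) {w y z : V} (hw : w ∈ W) (hwL : 1 ≤ nb G w L)
    (hy : y ∈ M) (hz : z ∈ M) (hyz : y ≠ z) (hwy : G.Adj w y) (hwz : G.Adj w z) :
    Tiles G (insert w ((insert x (M.erase y)).erase z)) k s := by
  have hxM := h.notMem_M
  have hxL := h.notMem_L
  have hxW := h.notMem_W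
  have dWM := Finset.disjoint_left.1 h.disjoint_WM
  have dLM := Finset.disjoint_left.1 h.disjoint_LM
  have hxy : x ≠ y := fun e => hxM (e ▸ hy)
  have hk := h.add_two
  have hr := h.nine_le
  have hdeg := (nb_erase_erase_insert_lt hwL (by rw [Finset.disjoint_left]; grind) hy hz hyz
    hxy hwy hwz).trans (h.sparse.deg w _)
  refine (h.swap hy hxM ((h.nb_x _).trans_lt (by omega))).swap (x := x) (y := z) (v := w)
    h.sparse h.nine_le h.add_two h.disjoint_WL ?_ ?_ h.card_W h.card_L ?_ ?_ ?_ ?_ ?_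
  · rw [Finset.disjoint_left]; grind
  · rw [Finset.disjoint_left]; grind
  · intro v hv
    rcases Finset.mem_insert.1 hv with rfl | hv
    · exact h.one_le_nb
    · exact h.nb_MW v (Finset.mem_of_mem_erase hv)
  · intro v hv hvx
    exact h.nb_ML v (by grind)
  · grind
  · grind
  · omega

lemma adj_of_mem_solo (h : Stuck G r k s W L M x) {w y z : V} (hw : w ∈ W) (hwL : 1 ≤ nb G w L)
    (hy : y ∈ solo G W M w) (hz : z ∈ solo G W M w) (hyz : y ≠ z) : G.Adj y z := by
  by_contra hadj
  obtain ⟨hyM, hwy, -⟩ := mem_solo.1 hy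
  obtain ⟨hzM, hwz, -⟩ := mem_solo.1 hz
  have dWL := Finset.disjoint_left.1 h.disjoint_WL
  have dWM := Finset.disjoint_left.1 h.disjoint_WM
  have dLM := Finset.disjoint_left.1 h.disjoint_LM
  have hxM := h.notMem_M
  have hxL := h.notMem_L
  have hxW := h.notMem_W
  refine h.not_tiles_of (h.swap_swap hw hwL hyM hzM hyz hwy hwz) h.indep_L h.card_L
    (h.indep_W.replace_two hy hz hadj)
    (card_replace_two h.card_W hw (fun e => dWM e hyM) (fun e => dWM e hzM) hyz) ?_ ?_ ?_ ?_
  all_goals clear h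
  all_goals grind

lemma card_solo_le_seven (h : Stuck G r k s W L M x) {w : V} (hw : w ∈ W) :
    (solo G W M w).card ≤ 7 := by
  obtain ⟨c, C, hC, hc, hs⟩ := h.tiles
  refine h.sparse.card_le_seven (N := M.filter (G.Adj w)) (c := c)
    (fun y hy => (mem_solo.1 hy).2.1) (fun y hy => ?_) fun y hy z hz hyz hadj =>
      ⟨C, hc.1 y (mem_solo.1 hy).1, ?_, ?_⟩
  · have := mem_solo.1 hy
    exact Finset.mem_filter.2 ⟨this.1, this.2.1⟩
  · have := h.sparse.deg w M
    rw [hC, h.add_two]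
    exact this
  · by_contra! hfree
    obtain ⟨i, hi, hfree⟩ := hfree
    have hyM := (mem_solo.1 hy).1
    have hzM := (mem_solo.1 hz).1
    have dWL := Finset.disjoint_left.1 h.disjoint_WL
    have dWM := Finset.disjoint_left.1 h.disjoint_WM
    have dLM := Finset.disjoint_left.1 h.disjoint_LM
    have hT := hc.swap (x := x) (y := y) (v := w) h.sparse h.nine_le hs (hC ▸ h.add_two)
      h.disjoint_WL h.disjoint_WM h.disjoint_LM h.card_W h.card_L h.nb_MW
      (fun u hu _ => h.nb_ML u hu) hyM (dWM hw) ⟨i, hi, fun u hu hui hadj =>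
        hfree u (Finset.mem_filter.2 ⟨Finset.mem_of_mem_erase hu, hadj⟩)
          (Finset.ne_of_mem_erase hu) hui⟩
    rw [hC] at hT
    refine h.not_overlap (z := z) (h.indep_W.replace_two hy hz hadj)
      (card_replace_two h.card_W hw (fun e => dWM e hyM) (fun e => dWM e hzM) hyz)
      (hT.cons h.indep_L h.card_L (by rw [Finset.disjoint_left]; grind)) ?_ ?_ ?_ ?_
    all_goals clear h hfree
    all_goals grind

lemma solo_union (W L M : Finset V) (w : V) :
    solo G W (L ∪ M) w = solo G W L w ∪ solo G W M w := by
  ext y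
  simp only [mem_solo, Finset.mem_union]
  tauto

lemma adj_of_mem_solo_of_mem_solo (h : Stuck G r k s W L M x) {w y l : V} (hw : w ∈ W)
    (hwL : 2 ≤ nb G w L) (hy : y ∈ solo G W M w) (hl : l ∈ solo G W L w) : G.Adj y l := by
  by_contra hadj
  have hyM := (mem_solo.1 hy).1
  have hlL := (mem_solo.1 hl).1
  have dWL := Finset.disjoint_left.1 h.disjoint_WL
  have dWM := Finset.disjoint_left.1 h.disjoint_WM
  have dLM := Finset.disjoint_left.1 h.disjoint_LM
  have h1 := nb_erase_add_one hyM (mem_solo.1 hy).2.1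
  have h2 := h.sparse.deg w (L ∪ M)
  have hk := h.add_two
  rw [nb_union _ h.disjoint_LM] at h2
  have hT := h.swap hyM (dWM hw) (by omega)
  have hy' : y ∈ solo G W (L ∪ M) w := solo_union W L M w ▸ Finset.mem_union_right _ hy
  have hl' : l ∈ solo G W (L ∪ M) w := solo_union W L M w ▸ Finset.mem_union_left _ hl
  refine h.not_overlap (z := l) (h.indep_W.replace_two hy' hl' hadj)
    (card_replace_two h.card_W hw (fun e => dWM e hyM) (fun e => dWL e hlL)
      fun e => dLM hlL (e ▸ hyM))
    (hT.cons h.indep_L h.card_L (by rw [Finset.disjoint_left]; grind)) ?_ ?_ ?_ ?_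
  all_goals clear h
  all_goals grind

lemma exists_five_le_card_solo (h : Stuck G r k s W L M x) :
    ∃ w ∈ W, 1 ≤ nb G w L ∧ 5 ≤ (solo G W L w).card := by
  have hk := h.add_two
  have hr := h.nine_le
  obtain ⟨w, hw, hq⟩ := exists_large_solo (G := G) (W := W) (M := L ∪ M) (k := k + 1) h.card_W
    (by rw [Finset.card_union_of_disjoint h.disjoint_LM, h.card_L, h.tiles.card]; ring) (by omega)
    (fun y hy => (Finset.mem_union.1 hy).elim (h.nb_LW y) (h.nb_MW y))
  have hdeg := h.sparse.deg w (L ∪ M)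
  rw [nb_union _ h.disjoint_LM] at hq hdeg
  have hsplitc := Finset.card_union_le (solo G W L w) (solo G W M w)
  rw [← solo_union] at hsplitc
  have hsL := card_solo_le (G := G) W L w
  have h7 := h.card_solo_le_seven hw
  have hwL : 1 ≤ nb G w L := by omega
  have h6 : (solo G W M w).card ≤ 6 :=
    h.sparse.clique_card (w := w) (fun y hy => (mem_solo.1 hy).2.1)
      fun y hy z hz => h.adj_of_mem_solo hw hwL hy hz
  refine ⟨w, hw, hwL, ?_⟩
  by_contra! h4
  refine h.sparse.not_dense (w := w) (Q := solo G W (L ∪ M) w) (C := solo G W M w)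
    (fun y hy => (mem_solo.1 hy).2.1) (by omega) (by rw [solo_union]; simp) (by omega)
    fun y hy z hz hyz => ?_
  rw [solo_union] at hz
  rcases Finset.mem_union.1 hz with hz | hz
  · exact h.adj_of_mem_solo_of_mem_solo hw (by omega) hy hz
  · exact h.adj_of_mem_solo hw hwL hy hz hyz

lemma exists_six_le_card_solo (h : Stuck G r k s W L M x) :
    ∃ w ∈ W, nb G w L = 0 ∧ 6 ≤ (solo G W M w).card := by
  have hk := h.add_two
  have hr := h.nine_le
  obtain ⟨w, hw, hq⟩ := exists_large_solo h.card_W h.tiles.card (by omega) h.nb_MW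
  have h2 := h.sparse.deg w (L ∪ M)
  rw [nb_union _ h.disjoint_LM] at h2
  by_cases hwL : 1 ≤ nb G w L
  · have := h.sparse.clique_card (w := w) (fun y hy => (mem_solo.1 hy).2.1)
      fun y hy z hz => h.adj_of_mem_solo hw hwL hy hz
    omega
  · exact ⟨w, hw, by omega, by omega⟩

lemma adj_or_adj (h : Stuck G r k s W L M x) {w₀ w₁ y l l' : V} (hw₀ : w₀ ∈ W) (hw₁ : w₁ ∈ W)
    (hw₀L : nb G w₀ L = 0) (hw₁L : 3 ≤ nb G w₁ L) (hy : y ∈ solo G W M w₀)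
    (hl : l ∈ solo G W L w₁) (hl' : l' ∈ solo G W L w₁) (hll : l ≠ l') :
    G.Adj y l ∨ G.Adj y l' := by
  by_contra! hn
  obtain ⟨hyl, hyl'⟩ := hn
  have h01 : w₀ ≠ w₁ := fun e => by rw [e] at hw₀L; omega
  have dWL := Finset.disjoint_left.1 h.disjoint_WL
  have dWM := Finset.disjoint_left.1 h.disjoint_WM
  have dLM := Finset.disjoint_left.1 h.disjoint_LM
  obtain ⟨hyM, hy0, hys⟩ := mem_solo.1 hy
  obtain ⟨hlL, hl1, hls⟩ := mem_solo.1 hl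
  obtain ⟨hlL', hl1', hls'⟩ := mem_solo.1 hl'
  have hk := h.add_two
  have h2 := h.sparse.deg w₁ (L ∪ M)
  rw [nb_union _ h.disjoint_LM] at h2
  have hT := h.swap hyM (dWM hw₁) ((nb_mono w₁ (Finset.erase_subset _ _)).trans_lt (by omega))
  have hI : Indep G (insert l (insert l' (insert y ((W.erase w₀).erase w₁)))) := by
    have h1 := G.adj_comm l' y
    have h2 := G.adj_comm l y
    have h3 := h.indep_L l hlL l' hlL'
    refine (((h.indep_W.mono (by grind)).cons ?_).cons ?_).cons ?_
    all_goals clear h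
    all_goals grind
  have hI0 : Indep G (insert w₀ (L.erase l')) :=
    (h.indep_L.mono (Finset.erase_subset _ _)).cons fun u hu =>
      nb_eq_zero.1 hw₀L u (Finset.mem_of_mem_erase hu)
  have hT' := hT.cons hI0 (by rw [card_swap hlL' (dWL hw₀), h.card_L])
    (by rw [Finset.disjoint_left]; clear h; grind)
  have hc := h.card_W
  refine h.not_overlap (z := l) hI ?_ hT' ?_ ?_ ?_ ?_
  all_goals clear h
  · rw [Finset.card_insert_of_notMem (by grind), Finset.card_insert_of_notMem (by grind),
      Finset.card_insert_of_notMem (by grind), Finset.card_erase_add_one (by grind),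
      Finset.card_erase_add_one hw₀, hc]
  all_goals grind

lemma false (h : Stuck G r k s W L M x) : False := by
  obtain ⟨w₀, hw₀, hw₀L, h6⟩ := h.exists_six_le_card_solo
  obtain ⟨w₁, hw₁, -, h5⟩ := h.exists_five_le_card_solo
  have hsL := card_solo_le (G := G) W L w₁
  obtain ⟨A, hA, hAc⟩ := Finset.exists_subset_card_eq h6
  obtain ⟨B, hB, hBc⟩ := Finset.exists_subset_card_eq h5
  have hAB : 4 * A.card ≤ ∑ y ∈ A, nb G y B := by
    refine mul_card_le_sum_nb fun y hy => ?_
    have h1 : (B.filter fun l => ¬ G.Adj y l).card ≤ 1 := by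
      refine Finset.card_le_one.2 fun l hl l' hl' => ?_
      by_contra hll
      obtain ⟨hl, hyl⟩ := Finset.mem_filter.1 hl
      obtain ⟨hl', hyl'⟩ := Finset.mem_filter.1 hl'
      exact (h.adj_or_adj hw₀ hw₁ hw₀L (by omega) (hA hy) (hB hl) (hB hl') hll).elim hyl hyl'
    have h2 : nb G y B + (B.filter fun l => ¬ G.Adj y l).card = B.card :=
      Finset.card_filter_add_card_filter_not _
    omega
  have hAB' := h.sparse.between B A (Finset.disjoint_left.2 fun a ha ha' =>
    Finset.disjoint_left.1 h.disjoint_LM (mem_solo.1 (hB ha)).1 (mem_solo.1 (hA ha')).1)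
  omega

end Stuck

end DominatingClass

section Extension

variable {G : SimpleGraph V} {r s k : ℕ}

lemma reach_arith {d e : ℕ} (hde : 8 ≤ d + e) (h1 : d * (e * s) + 4 ≤ 2 * (d * s) + e * s + 2 * s)
    (h2 : d * (e * s) + 3 ≤ d * s + 2 * (e * s) + 2 * s) (hd : 2 ≤ d) (he : 2 ≤ e) : False := by
  obtain ⟨e, rfl⟩ := Nat.exists_eq_add_of_le he
  rcases Nat.eq_zero_or_pos e with rfl | he'
  · obtain ⟨d, rfl⟩ := Nat.exists_eq_add_of_le (show 6 ≤ d by omega)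
    nlinarith
  · obtain ⟨d, rfl⟩ := Nat.exists_eq_add_of_le hd
    have : 4 ≤ (d + 1) * e := by
      rcases Nat.lt_or_ge d 3 with h | h
      · interval_cases d <;> omega
      · nlinarith
    nlinarith [Nat.mul_le_mul_right s this]

lemma reach_dichotomy (hG : Sparse G r) (hr : 9 ≤ r) {W B : Finset V} {c : V → ℕ} {C D : Finset ℕ}
    {y : V} (hC : C.card + 1 = r) (hWB : Disjoint W B) (hWc : W.card + 1 = s)
    (hs : ∀ i ∈ C, (cls B c i).card = s) (hW : ∀ u ∈ B, 1 ≤ nb G u W) (hy : y ∈ B)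
    (hDC : D ⊆ C) (hyD : c y ∈ D)
    (hblock : ∀ u ∈ B.erase y, c u ∉ D → ∀ k ∈ D, ∃ v ∈ B.erase y, c v = k ∧ G.Adj u v) :
    D.card = 1 ∨ C.card ≤ D.card + 1 := by
  by_contra! hcon
  have hcE : (C \ D).card + D.card = C.card := Finset.card_sdiff_add_card_eq_card hDC
  have hd : 1 ≤ D.card := Finset.card_pos.2 ⟨_, hyD⟩
  have hs' : ∀ i ∈ C, (cls (B.erase y) c i).card + (if i = c y then 1 else 0) = s :=
    fun i hi => by rw [card_cls_erase_add hy, hs i hi]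
  have hSB : B.erase y ⊆ B := Finset.erase_subset _ _
  set S := B.erase y
  have hdisj := disjoint_filter_color S c C D
  have hsD := card_filter_color_eq hDC hs'
  have hsE := card_filter_color_eq (D := C \ D) Finset.sdiff_subset hs'
  rw [if_pos hyD] at hsD
  rw [if_neg (by simp [hyD]), add_zero] at hsE
  set SD := S.filter (c · ∈ D) with hSD
  set SE := S.filter (c · ∈ C \ D) with hSE
  have hSDB : SD ⊆ B := (Finset.filter_subset _ _).trans hSB
  have hSEB : SE ⊆ B := (Finset.filter_subset _ _).trans hSB
  have e1 : D.card * SE.card ≤ ∑ y ∈ SE, nb G y SD := mul_card_le_sum_nb fun y hy => by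
    simp only [hSE, Finset.mem_filter, Finset.mem_sdiff] at hy
    exact card_le_nb_of_forall_color (hblock y hy.1 hy.2.2)
  have e2 : ∀ Y ⊆ B, Y.card ≤ ∑ y ∈ Y, nb G y W := fun Y hY => by
    simpa using mul_card_le_sum_nb (a := 1) fun y hy => hW y (hY hy)
  have hWX : ∀ X ⊆ B, Disjoint W X := fun X hX => hWB.mono_right hX
  have cA := hG.between (W ∪ SD) SE (Finset.disjoint_union_left.2 ⟨hWX _ hSEB, hdisj⟩)
  have cB := hG.between (W ∪ SE) SD (Finset.disjoint_union_left.2 ⟨hWX _ hSDB, hdisj.symm⟩)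
  simp only [nb_union _ (hWX _ hSDB), nb_union _ (hWX _ hSEB), Finset.sum_add_distrib,
    Finset.card_union_of_disjoint (hWX _ hSDB), Finset.card_union_of_disjoint (hWX _ hSEB)]
    at cA cB
  have := e2 _ hSDB
  have := e2 _ hSEB
  have e4 := sum_nb_comm (G := G) SE SD
  rw [hsE] at e1
  refine reach_arith (s := s) (d := D.card) (e := (C \ D).card) (by omega) ?_ ?_ (by omega)
    (by omega)
  · omega
  · omega

lemma stuck_of_not_tiles (hG : Sparse G r) (hr : 9 ≤ r) {W B : Finset V} {c : V → ℕ}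
    {C : Finset ℕ} {x y : V} (hC : C.card + 1 = r) (hWB : Disjoint W B) (hWI : Indep G W)
    (hWc : W.card + 1 = s) (hc : PColor G B c C) (hs : ∀ i ∈ C, (cls B c i).card = s)
    (hW : ∀ u ∈ B, 1 ≤ nb G u W) (hxW : x ∉ W) (hxB : x ∉ B) (hx : ∀ X, nb G x X ≤ 6)
    (hnot : ¬ Tiles G (insert x (W ∪ B)) r s) (hy : y ∈ B)
    (hblock : ∀ u ∈ B, c u ≠ c y → ∃ v ∈ B, c v = c y ∧ G.Adj u v) :
    Stuck G r (C.erase (c y)).card s W (cls B c (c y)) (B \ cls B c (c y)) x := by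
  have hL : cls B c (c y) ⊆ B := Finset.filter_subset _ _
  have hyC := hc.1 y hy
  have hT : Tiles G (B \ cls B c (c y)) (C.erase (c y)).card s := by
    rw [← filter_erase_color hc]
    exact Tiles.of_filter hc fun i hi => hs i (Finset.mem_of_mem_erase hi)
  exact {
    sparse := hG
    nine_le := hr
    add_two := by rw [← hC, ← Finset.card_erase_add_one hyC]
    disjoint_WL := hWB.mono_right hL
    disjoint_WM := hWB.mono_right Finset.sdiff_subset
    disjoint_LM := Finset.disjoint_sdiff
    notMem_W := hxW
    notMem_L := fun h => hxB (hL h)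
    notMem_M := fun h => hxB (Finset.sdiff_subset h)
    indep_W := hWI
    indep_L := hc.indep_cls _
    card_W := hWc
    card_L := hs _ hyC
    tiles := hT
    nb_MW := fun u hu => hW u (Finset.sdiff_subset hu)
    nb_ML := fun u hu => by
      obtain ⟨hu, hu'⟩ := Finset.mem_sdiff.1 hu
      obtain ⟨v, hv, hvy, huv⟩ := hblock u hu fun e => hu' (mem_cls.2 ⟨hu, e⟩)
      exact nb_pos.2 ⟨v, mem_cls.2 ⟨hv, hvy⟩, huv⟩
    nb_LW := fun u hu => hW u (hL hu)
    nb_x := hx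
    not_tiles := by rwa [Finset.union_assoc, Finset.union_sdiff_of_subset hL] }

lemma Tiles.absorb (hG : Sparse G r) (hr : 9 ≤ r) {W B : Finset V} {x : V} (hk : k + 1 = r)
    (hB : Tiles G B k s) (hWB : Disjoint W B) (hWI : Indep G W) (hWc : W.card + 1 = s)
    (hxW : x ∉ W) (hxB : x ∉ B) (hx : ∀ X, nb G x X ≤ 6) : Tiles G (insert x (W ∪ B)) r s := by
  by_contra hnot
  have hW : ∀ u ∈ B, 1 ≤ nb G u W := by
    intro u hu
    by_contra hu0
    obtain ⟨k, rfl⟩ : ∃ l, k = l + 1 := ⟨k - 1, by omega⟩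
    obtain ⟨T, hTB, huT, hTI, hTc, hM⟩ := hB.split hu
    have := tiles_of_arc hG hr hk (hWB.mono_right hTB) (hWB.mono_right Finset.sdiff_subset)
      Finset.disjoint_sdiff hxW (fun h => hxB (hTB h)) (fun h => hxB (Finset.sdiff_subset h))
      hWI hTI hWc hTc hM huT (by omega) hx
    rw [Finset.union_assoc, Finset.union_sdiff_of_subset hTB] at this
    exact hnot this
  obtain ⟨w, hw, hq⟩ := exists_large_solo hWc hB.card (by omega) hW
  obtain ⟨c, C, rfl, hc, hs⟩ := hB
  have hdeg := hG.deg w B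
  suffices (solo G W B w).card ≤ 7 by omega
  have dWB := Finset.disjoint_left.1 hWB
  refine hG.card_le_seven (N := B.filter (G.Adj w)) (c := c)
    (fun y hy => (mem_solo.1 hy).2.1) (fun y hy => ?_) fun y hy z hz hyz hadj => ?_
  · have := mem_solo.1 hy
    exact Finset.mem_filter.2 ⟨this.1, this.2.1⟩
  have hyB := (mem_solo.1 hy).1
  have hzB := (mem_solo.1 hz).1
  obtain ⟨D, hDC, hyD, hblock, habs⟩ :=
    exists_reach (hc.mono (Finset.erase_subset y B)) (hc.1 y hyB)
  refine ⟨D, hyD, ?_, ?_⟩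
  · rcases reach_dichotomy hG hr hk hWB hWc hs hW hyB hDC hyD hblock with h1 | h1
    · refine ((stuck_of_not_tiles (y := y) hG hr hk hWB hWI hWc hc hs hW hxW hxB hx hnot hyB
        fun u hu huy => ?_).false).elim
      obtain ⟨i, rfl⟩ := Finset.card_eq_one.1 h1
      rw [Finset.mem_singleton] at hyD
      obtain ⟨v, hv, hvi, huv⟩ := hblock u
        (Finset.mem_erase.2 ⟨fun e => huy (congrArg c e), hu⟩)
        (by rwa [Finset.mem_singleton, ← hyD]) i (Finset.mem_singleton_self i)
      exact ⟨v, Finset.mem_of_mem_erase hv, hvi.trans hyD.symm, huv⟩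
    · change nb G w B ≤ _
      omega
  · by_contra! hfree
    obtain ⟨i, hi, hfree⟩ := hfree
    obtain ⟨c', h1, h2⟩ := habs w (fun h => dWB hw (Finset.mem_of_mem_erase h)) i hi
      fun u hu hui hadj => hfree u (Finset.mem_filter.2 ⟨Finset.mem_of_mem_erase hu, hadj⟩)
          (Finset.ne_of_mem_erase hu) hui
    have hT : Tiles G (insert w (B.erase y)) C.card s :=
      ⟨c', C, rfl, h1, fun i hi => by rw [h2 i hi, card_cls_erase_add hyB, hs i hi]⟩
    refine hnot (tiles_of_overlap hG hr hk (hWI.replace_two hy hz hadj)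
      (card_replace_two hWc hw (fun e => dWB e hyB) (fun e => dWB e hzB) hyz) hT (z := z)
      ?_ ?_ ?_ hx ?_ ?_ ?_)
    all_goals clear hfree habs hblock hs hW hnot hx
    all_goals grind

end Extension

section Divisible

variable {G : SimpleGraph V} {r s k : ℕ}

lemma Sparse.mono {G' : SimpleGraph V} (hG : Sparse G r) (h : G' ≤ G) : Sparse G' r := by
  have hnb : ∀ v X, nb G' v X ≤ nb G v X := fun v X =>
    Finset.card_le_card (Finset.monotone_filter_right _ fun u _ hu => h hu)
  exact ⟨fun v X => (hnb v X).trans (hG.deg v X),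
    fun S => (Finset.sum_le_sum fun v _ => hnb v S).trans (hG.within S),
    fun X Y hXY => (Finset.sum_le_sum fun v _ => hnb v X).trans (hG.between X Y hXY)⟩

lemma Sparse.exists_nb_le_six (hG : Sparse G r) {A : Finset V} (hA : A.Nonempty) :
    ∃ x ∈ A, nb G x A ≤ 6 := by
  refine Finset.exists_le_of_sum_le hA ((hG.within A).trans (le_of_eq ?_))
  rw [Finset.sum_const, smul_eq_mul, mul_comm]

lemma Tiles.of_adj {G' : SimpleGraph V} {S : Finset V} (hS : Tiles G' S k s)
    (h : ∀ u ∈ S, ∀ v ∈ S, G.Adj u v → G'.Adj u v) : Tiles G S k s := by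
  obtain ⟨c, C, hC, hc, hs⟩ := hS
  exact ⟨c, C, hC, ⟨hc.1, fun u hu v hv huv => hc.2 u hu v hv (h u hu v hv huv)⟩, hs⟩

lemma Indep.tiles {U : Finset V} (h : Indep G U) (hU : U.card = k * s) : Tiles G U k s := by
  induction k generalizing U with
  | zero =>
    obtain rfl : U = ∅ := by simpa using hU
    exact ⟨fun _ => 0, ∅, rfl, ⟨by simp, by simp⟩, by simp⟩
  | succ k ih =>
    obtain ⟨T, hT, hTc⟩ := Finset.exists_subset_card_eq (s := U) (n := s) (by rw [hU]; nlinarith)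
    have := (ih (h.mono (T' := U \ T) Finset.sdiff_subset)
      (by rw [Finset.card_sdiff_of_subset hT, hU, hTc, Nat.succ_mul, Nat.add_sub_cancel])).cons
      (h.mono hT) hTc Finset.sdiff_disjoint
    rwa [Finset.sdiff_union_of_subset hT] at this

/-- The subgraph of `G` formed by the edges with both endpoints in `A`. -/
def restrict (G : SimpleGraph V) (A : Finset V) : SimpleGraph V where
  Adj u v := G.Adj u v ∧ u ∈ A ∧ v ∈ A
  symm := ⟨fun _ _ h => ⟨h.1.symm, h.2.2, h.2.1⟩⟩
  loopless := ⟨fun _ h => G.loopless.irrefl _ h.1⟩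

lemma tiles_restrict (hG : Sparse G r) (hr : 9 ≤ r) {U : Finset V} (hU : U.card = r * s)
    {A : Finset V} (hA : A ⊆ U) : Tiles (restrict G A) U r s := by
  induction A using Finset.strongInduction with
  | H A ih =>
  rcases A.eq_empty_or_nonempty with rfl | hne
  · exact Indep.tiles (fun u _ v _ h => by simpa using h.2.1) hU
  obtain ⟨x, hxA, hx⟩ := hG.exists_nb_le_six hne
  obtain ⟨k, rfl⟩ : ∃ k, r = k + 1 := ⟨r - 1, by omega⟩
  obtain ⟨T, hTU, hxT, hTI, hTc, hB⟩ := (ih (A.erase x) (Finset.erase_ssubset hxA)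
    ((Finset.erase_subset _ _).trans hA)).split (hA hxA)
  have hadj : ∀ u v, u ≠ x → v ≠ x → (restrict G A).Adj u v →
      (restrict G (A.erase x)).Adj u v := fun u v hu hv h =>
    ⟨h.1, Finset.mem_erase.2 ⟨hu, h.2.1⟩, Finset.mem_erase.2 ⟨hv, h.2.2⟩⟩
  have hne : ∀ u ∈ U \ T, u ≠ x := fun u hu e => (Finset.mem_sdiff.1 hu).2 (e ▸ hxT)
  have := Tiles.absorb (G := restrict G A) (W := T.erase x) (x := x)
    (hG.mono fun _ _ h => h.1) hr rfl
    (hB.of_adj fun u hu v hv => hadj u v (hne u hu) (hne v hv))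
    (Finset.disjoint_sdiff.mono_left (Finset.erase_subset _ _))
    (fun u hu v hv h => hTI u (Finset.mem_of_mem_erase hu) v (Finset.mem_of_mem_erase hv)
      (hadj u v (Finset.ne_of_mem_erase hu) (Finset.ne_of_mem_erase hv) h))
    (by rw [Finset.card_erase_add_one hxT, hTc]) (Finset.notMem_erase _ _)
    (fun h => hne x h rfl) fun X => (Finset.card_le_card fun u hu => ?_).trans hx
  · rwa [← Finset.insert_union, Finset.insert_erase hxT, Finset.union_sdiff_of_subset hTU] at this
  · have := (Finset.mem_filter.1 hu).2
    exact Finset.mem_filter.2 ⟨this.2.2, this.1⟩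

lemma Sparse.tiles (hG : Sparse G r) (hr : 9 ≤ r) {U : Finset V} (hU : U.card = r * s) :
    Tiles G U r s :=
  (tiles_restrict hG hr hU subset_rfl).of_adj fun _ hu _ hv h => ⟨h, hu, hv⟩

end Divisible

section Remainder

variable {G : SimpleGraph V} {r s k : ℕ}

lemma Sparse.exists_pColor_of_add_six_le (hG : Sparse G r) (hr : 9 ≤ r) {S : Finset V} {t : ℕ}
    (hS : S.card = r * t + k) (hk : k + 6 ≤ r) : ∃ c C B, C.card = r ∧ B ⊆ C ∧ B.card = k ∧
      PColor G S c C ∧ ∀ i ∈ C, (cls S c i).card = t + if i ∈ B then 1 else 0 := by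
  induction k generalizing S with
  | zero =>
    obtain ⟨c, C, hC, hc, hs⟩ := hG.tiles hr hS
    exact ⟨c, C, ∅, hC, by simp, rfl, hc, by simpa using hs⟩
  | succ k ih =>
    obtain ⟨x, hxS, hx⟩ := hG.exists_nb_le_six (Finset.card_pos.1 (by omega : 0 < S.card))
    have hcard := Finset.card_erase_add_one hxS
    obtain ⟨c, C, B, hC, hBC, hB, hc, hs⟩ := ih (S := S.erase x) (by omega) (by omega)
    have hCB := Finset.card_sdiff_add_card_eq_card hBC
    obtain ⟨i, hi, hf⟩ := exists_free_color (S := S.erase x) (c := c) (D := C \ B) (v := x)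
      (((nb_mono x (Finset.erase_subset x S)).trans hx).trans_lt (by omega))
    obtain ⟨hiC, hiB⟩ := Finset.mem_sdiff.1 hi
    obtain ⟨c', hc', hs'⟩ := hc.extend (Finset.notMem_erase x S) hiC hf
    rw [Finset.insert_erase hxS] at hc' hs'
    refine ⟨c', C, insert i B, hC, Finset.insert_subset hiC hBC,
      by rw [Finset.card_insert_of_notMem hiB, hB], hc', fun j hj => ?_⟩
    rw [hs', hs j hj]
    by_cases h : j = i <;> simp [h, hiB]

lemma nb_sum_inl {W : Type*} (H : SimpleGraph W) (v : V) (X : Finset (V ⊕ W)) :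
    nb (G ⊕g H) (Sum.inl v) X = nb G v X.toLeft := by
  unfold nb
  rw [← Finset.card_map (s := X.toLeft.filter (G.Adj v)) Function.Embedding.inl]
  congr 1
  ext (u | u) <;> simp

lemma nb_sum_inr {W : Type*} (H : SimpleGraph W) (v : W) (X : Finset (V ⊕ W)) :
    nb (G ⊕g H) (Sum.inr v) X = nb H v X.toRight := by
  unfold nb
  rw [← Finset.card_map (s := X.toRight.filter (H.Adj v)) Function.Embedding.inr]
  congr 1
  ext (u | u) <;> simp

lemma sum_nb_sum {W : Type*} (H : SimpleGraph W) (X Y : Finset (V ⊕ W)) :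
    ∑ y ∈ Y, nb (G ⊕g H) y X = ∑ y ∈ Y.toLeft, nb G y X.toLeft +
      ∑ y ∈ Y.toRight, nb H y X.toRight := by
  conv_lhs => rw [← Finset.toLeft_disjSum_toRight (u := Y)]
  rw [Finset.sum_disjSum]
  simp only [nb_sum_inl, nb_sum_inr]

lemma Sparse.sum {W : Type*} {H : SimpleGraph W} (hG : Sparse G r) (hH : Sparse H r) :
    Sparse (G ⊕g H) r := by
  refine ⟨?_, fun S => ?_, fun X Y hXY => ?_⟩
  · rintro (v | v) X
    · exact nb_sum_inl H v X ▸ hG.deg v _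
    · exact nb_sum_inr H v X ▸ hH.deg v _
  · rw [sum_nb_sum, ← Finset.card_toLeft_add_card_toRight (u := S)]
    have := hG.within S.toLeft
    have := hH.within S.toRight
    omega
  · rw [Finset.disjoint_left] at hXY
    have h1 := hG.between X.toLeft Y.toLeft
      (Finset.disjoint_left.2 fun a ha ha' =>
        hXY (Finset.mem_toLeft.1 ha) (Finset.mem_toLeft.1 ha'))
    have h2 := hH.between X.toRight Y.toRight
      (Finset.disjoint_left.2 fun a ha ha' =>
        hXY (Finset.mem_toRight.1 ha) (Finset.mem_toRight.1 ha'))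
    rw [sum_nb_sum, ← Finset.card_toLeft_add_card_toRight (u := X),
      ← Finset.card_toLeft_add_card_toRight (u := Y)]
    omega

lemma sparse_of_card_le_five [Fintype V] (hV : Fintype.card V ≤ 5) (hr : 9 ≤ r) :
    Sparse G r := by
  have hnb : ∀ v X, nb G v X ≤ X.card := fun v X => Finset.card_filter_le _ _
  have hsum : ∀ X Y : Finset V, ∑ y ∈ Y, nb G y X ≤ Y.card * X.card := fun X Y =>
    Finset.sum_le_card_nsmul _ _ _ fun v _ => hnb v X
  have hc : ∀ X : Finset V, X.card ≤ 5 := fun X => X.card_le_univ.trans hV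
  refine ⟨fun v X => (hnb v X).trans ((hc X).trans (by omega)),
    fun S => (hsum S S).trans (Nat.mul_le_mul_right _ ((hc S).trans (by omega))),
    fun X Y hXY => (hsum X Y).trans ?_⟩
  have h := hc (X ∪ Y)
  rw [Finset.card_union_of_disjoint hXY] at h
  generalize X.card = a at *
  generalize Y.card = b at *
  obtain hb | hb : b ≤ 2 ∨ a ≤ 2 := by omega
  · nlinarith
  · nlinarith

lemma Sparse.exists_pColor_of_card_add [Fintype V] (hG : Sparse G r) (hr : 9 ≤ r) {t p : ℕ}
    (hV : Fintype.card V + p = r * (t + 1)) (hp : p ≤ 5) : ∃ c C, C.card = r ∧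
      PColor G Finset.univ c C ∧ ∀ i ∈ C, t ≤ (cls Finset.univ c i).card ∧
        (cls Finset.univ c i).card ≤ t + 1 := by
  obtain ⟨c, C, hC, hc, hs⟩ := (hG.sum (sparse_of_card_le_five (V := Fin p) (G := ⊤)
    (by simpa using hp) hr)).tiles (U := Finset.univ) (s := t + 1) hr
    (by rw [Finset.card_univ, Fintype.card_sum, Fintype.card_fin, hV])
  refine ⟨fun v => c (Sum.inl v), C, hC, ⟨fun v _ => hc.1 _ (Finset.mem_univ _),
    fun u _ v _ huv => hc.2 _ (Finset.mem_univ _) _ (Finset.mem_univ _) (by simpa using huv)⟩,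
    fun i hi => ?_⟩
  have h1 := hs i hi
  rw [← Finset.card_toLeft_add_card_toRight] at h1
  have h2 : (cls Finset.univ c i).toLeft = cls Finset.univ (fun v => c (Sum.inl v)) i := by
    ext v
    simp [mem_cls]
  have h3 : (cls Finset.univ c i).toRight.card ≤ 1 := by
    refine Finset.card_le_one.2 fun a ha b hb => ?_
    by_contra hab
    have ha := (mem_cls.1 (Finset.mem_toRight.1 ha)).2
    have hb := (mem_cls.1 (Finset.mem_toRight.1 hb)).2
    exact hc.2 (Sum.inr a) (Finset.mem_univ _) (Sum.inr b) (Finset.mem_univ _) (by simpa using hab)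
      (ha.trans hb.symm)
  rw [h2] at h1
  omega

lemma Sparse.exists_pColor [Fintype V] (hG : Sparse G r) (hr : 9 ≤ r) : ∃ c C t, C.card = r ∧
    PColor G Finset.univ c C ∧ ∀ i ∈ C, t ≤ (cls Finset.univ c i).card ∧
      (cls Finset.univ c i).card ≤ t + 1 := by
  have hdiv := Nat.div_add_mod (Fintype.card V) r
  have hmod := Nat.mod_lt (Fintype.card V) (show r > 0 by omega)
  by_cases hk : Fintype.card V % r + 6 ≤ r
  · obtain ⟨c, C, B, hC, -, -, hc, hs⟩ :=
      hG.exists_pColor_of_add_six_le hr (S := Finset.univ) hdiv.symm hk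
    refine ⟨c, C, Fintype.card V / r, hC, hc, fun i hi => ?_⟩
    rw [hs i hi]
    split_ifs <;> omega
  · obtain ⟨c, C, h⟩ := hG.exists_pColor_of_card_add hr (t := Fintype.card V / r)
      (p := r - Fintype.card V % r) (by rw [mul_add]; omega) (by omega)
    exact ⟨c, C, _, h⟩

end Remainder

section EdgeBounds

variable [Fintype V] {G : SimpleGraph V} {r : ℕ}

lemma sum_nb_le_two_mul_edgesWithin (S : Finset V) :
    ∑ v ∈ S, nb G v S ≤ 2 * edgesWithin G S := by
  unfold nb edgesWithin
  rw [← Finset.card_sigma]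
  refine Finset.card_le_mul_card_image_of_maps_to (f := fun p => s(p.1, p.2)) ?_ 2 ?_
  · rintro ⟨u, v⟩ h
    simp only [Finset.mem_sigma, Finset.mem_filter] at h
    simp [h]
  · intro e _
    induction e using Sym2.ind with
    | _ a b =>
    refine (Finset.card_le_card (t := {⟨a, b⟩, ⟨b, a⟩}) ?_).trans Finset.card_le_two
    rintro ⟨u, v⟩ h
    have := (Finset.mem_filter.1 h).2
    simp only [Sym2.eq_iff] at this
    rcases this with ⟨rfl, rfl⟩ | ⟨rfl, rfl⟩ <;> simp

lemma sum_nb_le_edgesBetween {X Y : Finset V} (h : Disjoint X Y) :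
    ∑ y ∈ Y, nb G y X ≤ edgesBetween G X Y := by
  unfold nb edgesBetween
  rw [← Finset.card_sigma]
  refine Finset.card_le_card_of_injOn (fun p => s(p.2, p.1)) ?_ ?_
  · rintro ⟨y, x⟩ hp
    simp only [Finset.coe_sigma, Set.mem_sigma_iff, Finset.mem_coe, Finset.mem_filter] at hp
    simp only [Finset.coe_filter, Set.mem_ofPred_eq, SimpleGraph.mem_edgeFinset,
      SimpleGraph.mem_edgeSet]
    exact ⟨hp.2.2.symm, x, hp.2.1, y, hp.1, rfl⟩
  · rintro ⟨y, x⟩ hp ⟨y', x'⟩ hp' heq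
    simp only [Finset.coe_sigma, Set.mem_sigma_iff, Finset.mem_coe, Finset.mem_filter] at hp hp'
    simp only [Sym2.eq_iff] at heq
    rcases heq with ⟨rfl, rfl⟩ | ⟨rfl, rfl⟩
    · rfl
    · exact absurd hp'.1 (Finset.disjoint_left.1 h hp.2.1)

lemma SemiPlanarBounds.sparse (hG : SemiPlanarBounds G) (hΔ : ∀ v : V, G.degree v ≤ r) :
    Sparse G r where
  deg v X := (Finset.card_le_card fun u hu => by simpa using (Finset.mem_filter.1 hu).2).trans
    ((G.card_neighborFinset_eq_degree v).le.trans (hΔ v))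
  within S := by
    have := sum_nb_le_two_mul_edgesWithin (G := G) S
    have := hG.1 S
    omega
  between X Y h := (sum_nb_le_edgesBetween h).trans (hG.2 X Y h)

lemma PColor.isEquitableColoring {c : V → ℕ} {C : Finset ℕ} {t : ℕ}
    (hc : PColor G Finset.univ c C) (hs : ∀ i ∈ C, t ≤ (cls Finset.univ c i).card ∧
      (cls Finset.univ c i).card ≤ t + 1) (f : C ≃ Fin r) :
    IsEquitableColoring G r fun v => f ⟨c v, hc.1 v (Finset.mem_univ v)⟩ := by
  refine ⟨fun u v huv h => ?_, fun i j => ?_⟩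
  · exact hc.2 u (Finset.mem_univ u) v (Finset.mem_univ v) huv
      (congrArg Subtype.val (f.injective h))
  · have hcls : ∀ i, (Finset.univ.filter fun v => f ⟨c v, hc.1 v (Finset.mem_univ v)⟩ = i) =
        cls Finset.univ c (f.symm i) := fun i => by
      ext v
      simp [mem_cls, ← Equiv.eq_symm_apply, Subtype.ext_iff]
    rw [hcls, hcls]
    have h1 := hs _ (f.symm i).2
    have h2 := hs _ (f.symm j).2
    omega

end EdgeBounds

/-- **Theorem 1.3.** Every graph with maximum degree at most `r ≥ 9` satisfying the
semi-planar edge bounds has an equitable `r`-coloring. -/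
theorem semiPlanar_equitable_coloring (V : Type*) [Fintype V] (G : SimpleGraph V)
    (r : ℕ) (hr : 9 ≤ r) (hΔ : ∀ v : V, G.degree v ≤ r)
    (hG : SemiPlanarBounds G) :
    ∃ c : V → Fin r, IsEquitableColoring G r c := by
  obtain ⟨c, C, t, hC, hc, hs⟩ := (hG.sparse hΔ).exists_pColor hr
  exact ⟨_, hc.isEquitableColoring hs (C.equivFinOfCardEq hC)⟩

end Equitable
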